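/- arXiv:1910.12066 — 7 statements merged into one kernel-verified Lean document; each statement's English description precedes it below -/
import Mathlib

section
/- Let $A$ be a $d \times n$ real matrix and $B$ an $n \times (n-d)$ real matrix such that the sequence $0 \to \mathbb{R}^{n-d} \xrightarrow{B} \mathbb{R}^n \xrightarrow{A} \mathbb{R}^d \to 0$ is exact (i.e., $B$ is injective, $A$ is surjective, and the range of $B$ equals the kernel of $A$). Write $b_1,\dots,b_n \in \mathbb{R}^{n-d}$ for the rows of $B$ and $a_1,\dots,a_n \in \mathbb{R}^d$ for the columns of $A$. Then for any partition $\{1,\dots,n\} = I \sqcup J$ and any natural number $r$ with $0 \le |I| - r \le n-d$ and $0 \le r \le d$, one has $\dim_{\mathbb{R}} \mathrm{span}(b_i \mid i \in I) = |I| - r$ if and only if $\dim_{\mathbb{R}} \mathrm{span}(a_j \mid j \in J) = d - r$. -/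
/-- Extending by zero identifies the kernel of the columns of `A` in `J` with the image under `B`
of the kernel of the rows of `B` in `I`, when `range B = ker A` and `J` is the complement of
`I`. -/
theorem Matrix.map_ker_submatrix_eq_of_range_eq_ker {K m ι k : Type*} [Field K] [Fintype ι]
    [Fintype k] {A : Matrix m ι K} {B : Matrix ι k K}
    (hexact : LinearMap.range B.mulVecLin = LinearMap.ker A.mulVecLin)
    {I J : Finset ι} (hIJ : ∀ i, i ∈ I ↔ i ∉ J) :
    (LinearMap.ker (B.submatrix ((↑) : I → ι) id).mulVecLin).map B.mulVecLin =
      (LinearMap.ker (A.submatrix id ((↑) : J → ι)).mulVecLin).map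
        (Function.ExtendByZero.linearMap K ((↑) : J → ι)) := by
  have mulVec_extend (x : ι → K) (hx : ∀ i ∈ I, x i = 0) :
      A.mulVec x = (A.submatrix id ((↑) : J → ι)).mulVec (fun j => x j) := by
    ext a
    simp only [Matrix.mulVec, dotProduct, Matrix.submatrix_apply, id]
    rw [Finset.sum_coe_sort J (fun i => A a i * x i)]
    refine (Finset.sum_subset (Finset.subset_univ J) fun i _ hi => ?_).symm
    rw [hx i ((hIJ i).2 hi), mul_zero]
  ext x
  constructor
  · rintro ⟨y, hy, rfl⟩
    have hzero : ∀ i ∈ I, B.mulVec y i = 0 := fun i hi => congrFun hy ⟨i, hi⟩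
    have hker : A.mulVec (B.mulVec y) = 0 :=
      LinearMap.mem_ker.1 (hexact ▸ LinearMap.mem_range_self B.mulVecLin y)
    refine ⟨fun j => B.mulVec y j, ?_, ?_⟩
    · exact (mulVec_extend _ hzero).symm.trans hker
    · ext i
      by_cases hi : i ∈ J
      · exact Subtype.val_injective.extend_apply (fun j : J => B.mulVec y j) 0 ⟨i, hi⟩
      · refine (Function.extend_apply' (fun j : J => B.mulVec y j) (0 : ι → K) i ?_).trans
          (hzero i ((hIJ i).2 hi)).symm
        rintro ⟨j, rfl⟩
        exact hi j.2
  · rintro ⟨z, hz, rfl⟩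
    set x := Function.ExtendByZero.linearMap K ((↑) : J → ι) z
    have hzero : ∀ i ∈ I, x i = 0 := by
      intro i hi
      refine Function.extend_apply' _ _ _ ?_
      rintro ⟨j, rfl⟩
      exact (hIJ _).1 hi j.2
    have hres : (fun j : J => x j) = z :=
      funext fun j => Subtype.val_injective.extend_apply z 0 j
    have hker : x ∈ LinearMap.ker A.mulVecLin := by
      refine (mulVec_extend x hzero).trans ?_
      rw [hres]
      exact hz
    obtain ⟨y, hy⟩ := hexact.symm ▸ hker
    exact ⟨y, funext fun i => (congrFun hy i).trans (hzero i i.2), hy⟩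

/-- The rank form of Gale duality: for `B` injective with range the kernel of `A` and `J` the
complement of `I`, the nullities of the rows of `B` in `I` and of the columns of `A` in `J`
agree. -/
theorem Matrix.rank_submatrix_add_card_eq_of_range_eq_ker {K m ι k : Type*} [Field K] [Fintype ι]
    [Fintype k] {A : Matrix m ι K} {B : Matrix ι k K}
    (hB : Function.Injective B.mulVecLin)
    (hexact : LinearMap.range B.mulVecLin = LinearMap.ker A.mulVecLin)
    {I J : Finset ι} (hIJ : ∀ i, i ∈ I ↔ i ∉ J) :
    (B.submatrix ((↑) : I → ι) id).rank + J.card =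
      (A.submatrix id ((↑) : J → ι)).rank + Fintype.card k := by
  have hext : Function.Injective (Function.ExtendByZero.linearMap K ((↑) : J → ι)) :=
    Function.extend_injective Subtype.val_injective (0 : ι → K)
  have hker := congrArg (fun S : Submodule K (ι → K) => Module.finrank K S)
    (map_ker_submatrix_eq_of_range_eq_ker hexact hIJ)
  simp only [← (Submodule.equivMapOfInjective _ hB _).finrank_eq,
    ← (Submodule.equivMapOfInjective _ hext _).finrank_eq] at hker
  have hrankB := (B.submatrix ((↑) : I → ι) id).mulVecLin.finrank_range_add_finrank_ker
  have hrankA := (A.submatrix id ((↑) : J → ι)).mulVecLin.finrank_range_add_finrank_ker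
  rw [Module.finrank_fintype_fun_eq_card] at hrankA hrankB
  rw [Fintype.card_coe] at hrankA
  unfold Matrix.rank
  omega


/-- Gale duality: if `0 → ℝ^{n-d} → ℝ^n → ℝ^d → 0` is exact via `B` and `A`,
then for a partition `I ⊔ J` of the index set and `0 ≤ |I| - r ≤ n - d`, `0 ≤ r ≤ d`,
the span of the rows `b_i` (`i ∈ I`) of `B` has dimension `|I| - r` iff
the span of the columns `a_j` (`j ∈ J`) of `A` has dimension `d - r`. -/
theorem gale_duality (d n : ℕ) (hdn : d ≤ n)
    (A : Matrix (Fin d) (Fin n) ℝ) (B : Matrix (Fin n) (Fin (n - d)) ℝ)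
    (hBinj : Function.Injective B.mulVecLin)
    (hAsurj : Function.Surjective A.mulVecLin)
    (hexact : LinearMap.range B.mulVecLin = LinearMap.ker A.mulVecLin)
    (I J : Finset (Fin n)) (hdisj : Disjoint I J) (hunion : I ∪ J = Finset.univ)
    (r : ℕ) (hr₁ : r ≤ I.card) (hr₂ : I.card - r ≤ n - d) (hr₃ : r ≤ d) :
    Module.finrank ℝ (Submodule.span ℝ ((fun i : Fin n => B i) '' (I : Set (Fin n)))) =
        I.card - r ↔
    Module.finrank ℝ (Submodule.span ℝ ((fun j : Fin n => A.transpose j) '' (J : Set (Fin n)))) =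
        d - r := by
  have hIJ : ∀ i, i ∈ I ↔ i ∉ J := fun i =>
    ⟨fun hi => Finset.disjoint_left.1 hdisj hi, fun hi =>
      (Finset.mem_union.1 (hunion ▸ Finset.mem_univ i)).resolve_right hi⟩
  have hrank := Matrix.rank_submatrix_add_card_eq_of_range_eq_ker hBinj hexact hIJ
  have hcard : I.card + J.card = n := by
    rw [← Finset.card_union_of_disjoint hdisj, hunion, Finset.card_univ, Fintype.card_fin]
  rw [Matrix.rank_eq_finrank_span_row, Matrix.rank_eq_finrank_span_cols, Fintype.card_fin] at hrank
  have hrow : Set.range (B.submatrix ((↑) : I → Fin n) id).row =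
      (fun i : Fin n => B i) '' (I : Set (Fin n)) := by
    rw [Set.image_eq_range]
    rfl
  have hcol : Set.range (A.submatrix id ((↑) : J → Fin n)).col =
      (fun j : Fin n => A.transpose j) '' (J : Set (Fin n)) := by
    rw [Set.image_eq_range]
    rfl
  rw [hrow, hcol] at hrank
  omega
end

section
/- Let $d \le n$ and let $A = [a_1,\dots,a_n]$ be a $d \times n$ integer matrix of rank $d$ such that every $d \times d$ minor of $A$ lies in $\{-1,0,1\}$ (unimodularity) and such that for every index $j$, the matrix obtained from $A$ by deleting the $j$-th column still has rank $d$. Let $f_i = \sum_{j=1}^n A_{ij}\, z_j w_j$ for $i = 1,\dots,d$ in the polynomial ring $\mathbb{C}[z_1,\dots,z_n,w_1,\dots,w_n]$. Then the quotient ring $\mathbb{C}[z_1,\dots,z_n,w_1,\dots,w_n]/(f_1,\dots,f_d)$ is an integral domain whose Krull dimension equals $2n - d$. -/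
/-- An injective integral ring extension preserves the Krull dimension. -/
theorem ringKrullDim_eq_of_isIntegral_of_injective {R S : Type*} [CommRing R] [CommRing S]
    [Algebra R S] [Algebra.IsIntegral R S] (hinj : Function.Injective (algebraMap R S)) :
    ringKrullDim R = ringKrullDim S := by
  refine le_antisymm ?_ ?_
  · refine iSup_le fun l => ?_
    obtain ⟨P, -, hP, hPl⟩ := Ideal.exists_ideal_over_prime_of_isIntegral
      (RelSeries.head l).asIdeal (⊥ : Ideal S)
      (by rw [← RingHom.ker_eq_comap_bot, (RingHom.injective_iff_ker_eq_bot _).mp hinj]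
          exact bot_le)
    have : P.LiesOver (RelSeries.head l).asIdeal := ⟨hPl.symm⟩
    obtain ⟨L, hL, -, -⟩ := Ideal.exists_ltSeries_of_hasGoingUp (S := S) l P
    rw [← hL]
    exact Order.LTSeries.length_le_krullDim L
  · exact Order.krullDim_le_of_strictMono (PrimeSpectrum.comap (algebraMap R S))
      fun _ _ h => Ideal.IsIntegral.comap_lt_comap h

open scoped Matrix in
/-- An integer matrix whose rank equals its number of rows has a nonzero maximal minor. -/
theorem Matrix.exists_embedding_det_submatrix_ne_zero {d : ℕ} {κ : Type*} [Fintype κ]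
    (M : Matrix (Fin d) κ ℤ) (hM : M.rank = d) :
    ∃ σ : Fin d ↪ κ, (M.submatrix id σ).det ≠ 0 := by
  classical
  obtain ⟨v, hv⟩ := exists_linearIndependent_of_le_finrank (R := ℤ)
    (M := LinearMap.range M.mulVecLin) (n := d) (le_of_eq hM.symm)
  choose u hu using fun i => (v i).2
  have hv' : LinearIndependent ℤ (fun i => (v i : Fin d → ℤ)) :=
    hv.map' (Submodule.subtype _) (Submodule.ker_subtype _)
  have hcol : (fun i => (v i : Fin d → ℤ)) = (M * (Matrix.of u)ᵀ).col := by
    funext i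
    rw [← hu i]
    rfl
  rw [hcol] at hv'
  have hdet : (M * (Matrix.of u)ᵀ).det ≠ 0 := by
    intro h0
    rw [← Matrix.det_transpose] at h0
    obtain ⟨w, hw, hw0⟩ := Matrix.exists_vecMul_eq_zero_iff.mpr h0
    rw [Matrix.vecMul_transpose] at hw0
    exact hw (Matrix.mulVec_injective_iff.mpr hv' (by simpa using hw0))
  set f : ℤ →+* ℚ := Int.castRingHom ℚ
  have hdetQ : IsUnit ((M.map f) * ((Matrix.of u)ᵀ).map f) := by
    rw [Matrix.isUnit_iff_isUnit_det, isUnit_iff_ne_zero, ← Matrix.map_mul,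
      ← RingHom.mapMatrix_apply, ← RingHom.map_det]
    simpa [f] using hdet
  have hspan : Submodule.span ℚ (Set.range (M.map f).col) = ⊤ := by
    rw [← Matrix.range_mulVecLin, LinearMap.range_eq_top]
    intro y
    obtain ⟨x, hx⟩ := (Matrix.mulVec_surjective_iff_isUnit.mpr hdetQ) y
    exact ⟨((Matrix.of u)ᵀ).map f *ᵥ x, by simpa using hx⟩
  obtain ⟨τ, a, ha, hsp, hli⟩ := exists_linearIndependent' ℚ (M.map f).col
  rw [hspan] at hsp
  have := Fintype.ofInjective a ha
  have hcard : Fintype.card τ = d := by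
    simpa using (Module.finrank_eq_card_basis (Module.Basis.mk hli hsp.ge)).symm
  let e : Fin d ≃ τ := (Fintype.equivFinOfCardEq hcard).symm
  refine ⟨e.toEmbedding.trans ⟨a, ha⟩, fun h0 => ?_⟩
  have hu : IsUnit ((M.map f).submatrix id (a ∘ e)) :=
    Matrix.linearIndependent_cols_iff_isUnit.mp (hli.comp e e.injective)
  rw [Matrix.isUnit_iff_isUnit_det, isUnit_iff_ne_zero] at hu
  refine hu ?_
  have := congrArg f h0
  rw [RingHom.map_det, map_zero] at this
  exact this

namespace HyperbolicIdeal

open MvPolynomial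

/-- The row operations given by `M` act on the moment map components of `N`. -/
theorem sum_mul_apply_mul_X_mul_X {ι κ κ' K : Type*} [Fintype ι] [Fintype κ'] [Field K]
    (M : Matrix κ κ' K) (N : Matrix κ' ι K) (i : κ) :
    (∑ j, C ((M * N) i j) * X (Sum.inl j) * X (Sum.inr j) : MvPolynomial (ι ⊕ ι) K) =
      ∑ l, C (M i l) * ∑ j, C (N l j) * X (Sum.inl j) * X (Sum.inr j) := by
  simp only [Matrix.mul_apply, map_sum, map_mul, Finset.sum_mul, Finset.mul_sum, mul_assoc]
  exact Finset.sum_comm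

variable {ι K : Type*} [Fintype ι] [DecidableEq ι] [Field K]

/-- The quadratic form `∑ B k j zⱼ wⱼ`, summed over the indices `j` outside `s`. -/
noncomputable def residual (s : Finset ι) (B : ι → ι → K) (k : ι) : MvPolynomial (ι ⊕ ι) K :=
  ∑ j ∈ sᶜ, C (B k j) * X (Sum.inl j) * X (Sum.inr j)

/-- The ideal generated by the polynomials `zₖ wₖ - ∑ B k j zⱼ wⱼ` for `k` in `s`. -/
noncomputable def ideal (s : Finset ι) (B : ι → ι → K) : Ideal (MvPolynomial (ι ⊕ ι) K) :=
  Ideal.span ((fun k => X (Sum.inl k) * X (Sum.inr k) - residual s B k) '' s)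

variable (s : Finset ι) (B : ι → ι → K)

/-- The multiplicity of `zₖ wₖ` in the monomial with exponent `m`, for `k` in `s`. -/
def pairMult (m : ι ⊕ ι →₀ ℕ) (k : ι) : ℕ :=
  if k ∈ s then min (m (Sum.inl k)) (m (Sum.inr k)) else 0

/-- What remains of the exponent `m` once all products `zₖ wₖ` with `k` in `s` are removed. -/
noncomputable def reducedExp (m : ι ⊕ ι →₀ ℕ) : ι ⊕ ι →₀ ℕ :=
  Finsupp.equivFunOnFinite.symm fun x => m x - pairMult s m (x.elim id id)

/-- The normal form map, replacing every product `zₖ wₖ` with `k` in `s` by `residual s B k`. -/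
noncomputable def normalForm : MvPolynomial (ι ⊕ ι) K →ₗ[K] MvPolynomial (ι ⊕ ι) K :=
  (basisMonomials (ι ⊕ ι) K).constr K fun m =>
    (∏ k, residual s B k ^ pairMult s m k) * monomial (reducedExp s m) 1

theorem normalForm_monomial (m : ι ⊕ ι →₀ ℕ) :
    normalForm s B (monomial m 1) =
      (∏ k, residual s B k ^ pairMult s m k) * monomial (reducedExp s m) 1 := by
  have := (basisMonomials (ι ⊕ ι) K).constr_basis K (fun m =>
    (∏ k, residual s B k ^ pairMult s m k) * monomial (reducedExp s m) (1 : K)) m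
  rwa [coe_basisMonomials] at this

variable {s} in
theorem normalForm_X_mul_X_mul {k : ι} (hk : k ∈ s) (p : MvPolynomial (ι ⊕ ι) K) :
    normalForm s B (X (Sum.inl k) * X (Sum.inr k) * p) = residual s B k * normalForm s B p := by
  suffices normalForm s B ∘ₗ LinearMap.mulLeft K (X (Sum.inl k) * X (Sum.inr k)) =
      LinearMap.mulLeft K (residual s B k) ∘ₗ normalForm s B from LinearMap.congr_fun this p
  refine (basisMonomials (ι ⊕ ι) K).ext fun m => ?_
  simp only [coe_basisMonomials, LinearMap.comp_apply, LinearMap.mulLeft_apply, X,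
    monomial_mul, one_mul, normalForm_monomial]
  set e : ι ⊕ ι →₀ ℕ := Finsupp.single (Sum.inl k) 1 + Finsupp.single (Sum.inr k) 1 + m with he
  have hmult : ∀ l, pairMult s e l = pairMult s m l + if l = k then 1 else 0 := by
    intro l
    by_cases hl : l = k
    · subst hl
      simp [pairMult, he, hk]
      omega
    · simp [pairMult, he, hl]
  have hred : reducedExp s e = reducedExp s m := by
    ext x
    change e x - pairMult s e _ = m x - pairMult s m _
    rw [hmult]
    rcases x with l | l <;> by_cases hl : l = k
    · simp [hl, he]; omega
    · simp [hl, he]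
    · simp [hl, he]; omega
    · simp [hl, he]
  simp only [hred, hmult, pow_add, Finset.prod_mul_distrib]
  simp only [pow_ite, pow_one, pow_zero, Finset.prod_ite_eq', Finset.mem_univ, if_true]
  ring

variable {s} in
theorem normalForm_X_mul {x : ι ⊕ ι} (hx : x.elim id id ∉ s) (p : MvPolynomial (ι ⊕ ι) K) :
    normalForm s B (X x * p) = X x * normalForm s B p := by
  suffices normalForm s B ∘ₗ LinearMap.mulLeft K (X x) =
      LinearMap.mulLeft K (X x) ∘ₗ normalForm s B from LinearMap.congr_fun this p
  refine (basisMonomials (ι ⊕ ι) K).ext fun m => ?_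
  simp only [coe_basisMonomials, LinearMap.comp_apply, LinearMap.mulLeft_apply, X,
    monomial_mul, one_mul, normalForm_monomial]
  have hmult : ∀ l, pairMult s (Finsupp.single x 1 + m) l = pairMult s m l := by
    intro l
    by_cases hl : l ∈ s
    · have h1 : x ≠ Sum.inl l := by rintro rfl; exact hx hl
      have h2 : x ≠ Sum.inr l := by rintro rfl; exact hx hl
      simp [pairMult, hl, h1, h2]
    · simp [pairMult, hl]
  have hred : reducedExp s (Finsupp.single x 1 + m) = Finsupp.single x 1 + reducedExp s m := by
    ext y
    by_cases hy : x = y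
    · subst hy
      simp [reducedExp, pairMult, hx]
    · simp [reducedExp, hmult, Finsupp.single_apply, hy]
  simp only [hmult, hred]
  rw [mul_left_comm, monomial_mul, one_mul]

theorem normalForm_residual_mul (k : ι) (p : MvPolynomial (ι ⊕ ι) K) :
    normalForm s B (residual s B k * p) = residual s B k * normalForm s B p := by
  simp only [residual, Finset.sum_mul, map_sum, mul_assoc]
  refine Finset.sum_congr rfl fun j hj => ?_
  have hj' : j ∉ s := Finset.mem_compl.mp hj
  rw [C_mul', map_smul, normalForm_X_mul B (x := Sum.inl j) hj',
    normalForm_X_mul B (x := Sum.inr j) hj', C_mul']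

theorem normalForm_eq_zero_of_mem {p : MvPolynomial (ι ⊕ ι) K} (hp : p ∈ ideal s B) :
    normalForm s B p = 0 := by
  refine Submodule.span_induction (p := fun p _ => ∀ q, normalForm s B (q * p) = 0)
    ?_ (by simp) ?_ ?_ hp 1 |> fun h => by simpa using h
  · rintro _ ⟨k, hk, rfl⟩ q
    rw [mul_comm, sub_mul, map_sub, normalForm_X_mul_X_mul B hk, normalForm_residual_mul, sub_self]
  · intro x y _ _ hx hy q
    rw [mul_add, map_add, hx, hy, add_zero]
  · intro a x _ hx q
    rw [smul_eq_mul, ← mul_assoc, hx]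

variable {s} in
theorem mk_residual {k : ι} (hk : k ∈ s) :
    Ideal.Quotient.mk (ideal s B) (residual s B k) =
      Ideal.Quotient.mk (ideal s B) (X (Sum.inl k) * X (Sum.inr k)) := by
  refine (Ideal.Quotient.eq.mpr ?_).symm
  exact Ideal.subset_span (s := (fun k => X (Sum.inl k) * X (Sum.inr k) - residual s B k) '' s)
    ⟨k, hk, rfl⟩

theorem mk_normalForm (p : MvPolynomial (ι ⊕ ι) K) :
    Ideal.Quotient.mk (ideal s B) (normalForm s B p) = Ideal.Quotient.mk (ideal s B) p := by
  suffices (Ideal.Quotient.mkₐ K (ideal s B)).toLinearMap ∘ₗ normalForm s B =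
      (Ideal.Quotient.mkₐ K (ideal s B)).toLinearMap from LinearMap.congr_fun this p
  refine (basisMonomials (ι ⊕ ι) K).ext fun m => ?_
  simp only [coe_basisMonomials, LinearMap.comp_apply, AlgHom.toLinearMap_apply,
    Ideal.Quotient.mkₐ_eq_mk, normalForm_monomial, map_mul, map_prod, map_pow]
  have hres : ∀ k, Ideal.Quotient.mk (ideal s B) (residual s B k) ^ pairMult s m k =
      Ideal.Quotient.mk (ideal s B) ((X (Sum.inl k) * X (Sum.inr k)) ^ pairMult s m k) := by
    intro k
    by_cases hk : k ∈ s
    · rw [mk_residual B hk, map_pow]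
    · simp [pairMult, hk]
  simp only [hres, ← map_prod, ← map_mul]
  congr 1
  rw [monomial_eq, monomial_eq, C_1, one_mul, one_mul, Finsupp.prod_fintype _ _ (by simp),
    Finsupp.prod_fintype _ _ (by simp), Fintype.prod_sum_type, Fintype.prod_sum_type,
    ← Finset.prod_mul_distrib, ← Finset.prod_mul_distrib, ← Finset.prod_mul_distrib]
  refine Finset.prod_congr rfl fun k _ => ?_
  have h1 : pairMult s m k ≤ m (Sum.inl k) := by unfold pairMult; split_ifs <;> simp
  have h2 : pairMult s m k ≤ m (Sum.inr k) := by unfold pairMult; split_ifs <;> simp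
  simp only [reducedExp, Finsupp.equivFunOnFinite_symm_apply_apply, Sum.elim_inl, Sum.elim_inr, id]
  rw [mul_pow, mul_mul_mul_comm, ← pow_add, ← pow_add, Nat.add_sub_cancel' h1,
    Nat.add_sub_cancel' h2]

variable {s} in
/-- A variable `zₖ` with `k` outside `s` is a nonzerodivisor modulo `ideal s B`. -/
theorem mk_X_inl_mem_nonZeroDivisors {k : ι} (hk : k ∉ s) :
    Ideal.Quotient.mk (ideal s B) (X (Sum.inl k)) ∈
      nonZeroDivisors (MvPolynomial (ι ⊕ ι) K ⧸ ideal s B) := by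
  rw [mem_nonZeroDivisors_iff_right]
  intro y hy
  obtain ⟨p, rfl⟩ := Ideal.Quotient.mk_surjective y
  rw [mul_comm, ← map_mul, Ideal.Quotient.eq_zero_iff_mem] at hy
  have := normalForm_eq_zero_of_mem s B hy
  rw [normalForm_X_mul B (x := Sum.inl k) hk] at this
  rw [← mk_normalForm, (mul_eq_zero.mp this).resolve_left (X_ne_zero _), map_zero]

variable {s} in
theorem isPrime_ideal (h : ∀ k ∈ s, Ideal.Quotient.mk (ideal s B) (X (Sum.inl k)) ∈
      nonZeroDivisors (MvPolynomial (ι ⊕ ι) K ⧸ ideal s B)) : (ideal s B).IsPrime := by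
  let F := FractionRing (MvPolynomial (ι ⊕ ι) K)
  let θ := algebraMap (MvPolynomial (ι ⊕ ι) K) F
  let φ : MvPolynomial (ι ⊕ ι) K →ₐ[K] F := aeval (Sum.elim (fun k => θ (X (Sum.inl k)))
    fun k => if k ∈ s then θ (residual s B k) / θ (X (Sum.inl k)) else θ (X (Sum.inr k)))
  have hθ : Function.Injective θ := IsFractionRing.injective _ _
  have hinl : ∀ k, φ (X (Sum.inl k)) = θ (X (Sum.inl k)) := fun k => by simp [φ]
  have hinr : ∀ k ∉ s, φ (X (Sum.inr k)) = θ (X (Sum.inr k)) := fun k hk => by simp [φ, hk]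
  have hC : ∀ a : K, φ (C a) = θ (C a) := fun a => by
    rw [← algebraMap_eq, AlgHom.commutes, IsScalarTower.algebraMap_apply K
      (MvPolynomial (ι ⊕ ι) K) F]
  have hres : ∀ k, φ (residual s B k) = θ (residual s B k) := fun k => by
    simp only [residual, map_sum, map_mul]
    exact Finset.sum_congr rfl fun j hj => by rw [hC, hinl, hinr j (Finset.mem_compl.mp hj)]
  have hle : ideal s B ≤ RingHom.ker φ := by
    refine Ideal.span_le.mpr ?_
    rintro _ ⟨k, hk, rfl⟩
    have hne : θ (X (Sum.inl k)) ≠ 0 := by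
      rw [Ne, map_eq_zero_iff θ hθ]
      exact X_ne_zero _
    have : φ (X (Sum.inr k)) = θ (residual s B k) / θ (X (Sum.inl k)) := by
      simp [φ, Finset.mem_coe.mp hk]
    simp only [SetLike.mem_coe, RingHom.mem_ker, map_sub, map_mul, hinl, this, hres]
    rw [mul_div_cancel₀ _ hne, sub_self]
  have key : ∀ p, ∃ u q, Ideal.Quotient.mk (ideal s B) u ∈
      nonZeroDivisors (MvPolynomial (ι ⊕ ι) K ⧸ ideal s B) ∧ φ u = θ u ∧ φ q = θ q ∧
      Ideal.Quotient.mk (ideal s B) (u * p) = Ideal.Quotient.mk (ideal s B) q := by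
    intro p
    induction p using MvPolynomial.induction_on with
    | C a => exact ⟨1, C a, by simp [one_mem], by simp, hC a, by simp⟩
    | add p₁ p₂ h₁ h₂ =>
      obtain ⟨u₁, q₁, hu₁, hU₁, hq₁, e₁⟩ := h₁
      obtain ⟨u₂, q₂, hu₂, hU₂, hq₂, e₂⟩ := h₂
      refine ⟨u₁ * u₂, u₂ * q₁ + u₁ * q₂, ?_, ?_, ?_, ?_⟩
      · rw [map_mul]; exact mul_mem hu₁ hu₂
      · rw [map_mul, map_mul, hU₁, hU₂]
      · simp only [map_add, map_mul, hq₁, hq₂, hU₁, hU₂]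
      · simp only [map_add, map_mul] at e₁ e₂ ⊢
        linear_combination Ideal.Quotient.mk (ideal s B) u₂ * e₁ +
          Ideal.Quotient.mk (ideal s B) u₁ * e₂
    | mul_X p x hp =>
      obtain ⟨u, q, hu, hU, hq, e⟩ := hp
      by_cases hx : ∃ k ∈ s, x = Sum.inr k
      · obtain ⟨k, hk, rfl⟩ := hx
        refine ⟨u * X (Sum.inl k), q * residual s B k, ?_, ?_, ?_, ?_⟩
        · rw [map_mul]; exact mul_mem hu (h k hk)
        · rw [map_mul, map_mul, hU, hinl]
        · rw [map_mul, map_mul, hq, hres]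
        · rw [map_mul _ q, mk_residual B hk, ← e]
          simp only [map_mul]
          ring
      · refine ⟨u, q * X x, hu, hU, ?_, ?_⟩
        · rw [map_mul, map_mul, hq]
          rcases x with k | k
          · rw [hinl]
          · rw [hinr k fun hk => hx ⟨k, hk, rfl⟩]
        · rw [← mul_assoc, map_mul, e, map_mul]
  have hker : ideal s B = RingHom.ker φ := by
    refine le_antisymm hle fun p hp => ?_
    obtain ⟨u, q, hu, -, hq, e⟩ := key p
    have hq0 : φ q = 0 := by
      have := hle (Ideal.Quotient.eq.mp e)
      rw [RingHom.mem_ker, map_sub, map_mul, (RingHom.mem_ker).mp hp, mul_zero, zero_sub,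
        neg_eq_zero] at this
      exact this
    rw [hq, map_eq_zero_iff θ hθ] at hq0
    rw [hq0, map_zero, map_mul] at e
    exact Ideal.Quotient.eq_zero_iff_mem.mp ((mem_nonZeroDivisors_iff_left.mp hu) _ e)
  rw [hker]
  exact RingHom.ker_isPrime _

variable {s} in
theorem ringKrullDim_quotient_ideal :
    ringKrullDim (MvPolynomial (ι ⊕ ι) K ⧸ ideal s B) =
      ((Fintype.card ι + (Fintype.card ι - s.card) : ℕ) : WithBot (WithTop ℕ)) := by
  let P := MvPolynomial (ι ⊕ {j // j ∉ s}) K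
  let π := Ideal.Quotient.mkₐ K (ideal s B)
  let c : ι → P := fun k => ∑ j : {j // j ∉ s}, C (B k j) * X (Sum.inl j.1) * X (Sum.inr j)
  let ψ : P →ₐ[K] MvPolynomial (ι ⊕ ι) K ⧸ ideal s B := aeval (Sum.elim
    (fun k => if k ∈ s then π (X (Sum.inl k)) + π (X (Sum.inr k)) else π (X (Sum.inl k)))
    fun j => π (X (Sum.inr j.1)))
  have hsum : ∀ k, residual s B k =
      ∑ j : {j // j ∉ s}, C (B k j) * X (Sum.inl j.1) * X (Sum.inr j.1) := fun k =>
    Finset.sum_subtype (p := fun j => j ∉ s) _ (fun j => Finset.mem_compl)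
      (fun j => C (B k j) * X (Sum.inl j) * X (Sum.inr j))
  have hC : ∀ a : K, π (C a) = algebraMap K _ a := fun a => by
    rw [← algebraMap_eq, AlgHom.commutes]
  have hψinr : ∀ j : {j // j ∉ s}, ψ (X (Sum.inr j)) = π (X (Sum.inr j.1)) := fun j =>
    aeval_X _ _
  have hψinl : ∀ k ∉ s, ψ (X (Sum.inl k)) = π (X (Sum.inl k)) := fun k hk =>
    (aeval_X _ _).trans (if_neg hk)
  have hψinl' : ∀ k ∈ s, ψ (X (Sum.inl k)) = π (X (Sum.inl k)) + π (X (Sum.inr k)) :=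
    fun k hk => (aeval_X _ _).trans (if_pos hk)
  have hψc : ∀ k, ψ (c k) = π (residual s B k) := fun k => by
    simp only [hsum, c, map_sum, map_mul, hψinr]
    refine Finset.sum_congr rfl fun j _ => ?_
    rw [hψinl j.1 j.2, hC, ← algebraMap_eq, AlgHom.commutes]
  let : Algebra P (MvPolynomial (ι ⊕ ι) K ⧸ ideal s B) := ψ.toRingHom.toAlgebra
  have halg : ∀ p : P, algebraMap P (MvPolynomial (ι ⊕ ι) K ⧸ ideal s B) p = ψ p := fun _ => rfl
  have hint_inl : ∀ k, IsIntegral P (π (X (Sum.inl k))) := by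
    intro k
    by_cases hk : k ∈ s
    · refine ⟨Polynomial.X ^ 2 - Polynomial.C (X (Sum.inl k)) * Polynomial.X + Polynomial.C (c k),
        by monicity!, ?_⟩
      have := mk_residual B hk
      simp only [Polynomial.eval₂_add, Polynomial.eval₂_sub, Polynomial.eval₂_mul,
        Polynomial.eval₂_pow, Polynomial.eval₂_X, Polynomial.eval₂_C, halg, hψinl' k hk, hψc]
      rw [map_mul] at this
      change π (residual s B k) = π _ * π _ at this
      rw [this]
      ring
    · rw [← hψinl k hk, ← halg]
      exact isIntegral_algebraMap
  have hint_inr : ∀ k, IsIntegral P (π (X (Sum.inr k))) := by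
    intro k
    by_cases hk : k ∈ s
    · rw [← add_sub_cancel_left (π (X (Sum.inl k))) (π (X (Sum.inr k))), ← hψinl' k hk, ← halg]
      exact isIntegral_algebraMap.sub (hint_inl k)
    · rw [← hψinr ⟨k, hk⟩, ← halg]
      exact isIntegral_algebraMap
  have hint : Algebra.IsIntegral P (MvPolynomial (ι ⊕ ι) K ⧸ ideal s B) := by
    refine ⟨fun y => ?_⟩
    obtain ⟨p, rfl⟩ := Ideal.Quotient.mk_surjective y
    change IsIntegral P (π p)
    induction p using MvPolynomial.induction_on with
    | C a =>
      have : π (C a) = ψ (C a) := by rw [hC, ← algebraMap_eq, AlgHom.commutes]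
      rw [this, ← halg]
      exact isIntegral_algebraMap
    | add p q hp hq => rw [map_add]; exact hp.add hq
    | mul_X p x hp =>
      rw [map_mul]
      rcases x with k | k
      · exact hp.mul (hint_inl k)
      · exact hp.mul (hint_inr k)
  have hinj : Function.Injective (algebraMap P (MvPolynomial (ι ⊕ ι) K ⧸ ideal s B)) := by
    let L := AlgebraicClosure (FractionRing P)
    let θ : P →ₐ[K] L := IsScalarTower.toAlgHom K P L
    have hθ : Function.Injective θ := by
      change Function.Injective (algebraMap P L)
      rw [IsScalarTower.algebraMap_eq P (FractionRing P) L]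
      exact (algebraMap (FractionRing P) L).injective.comp (IsFractionRing.injective _ _)
    have hroot : ∀ k, ∃ α : L, α ^ 2 - θ (X (Sum.inl k)) * α + θ (c k) = 0 := by
      intro k
      obtain ⟨α, hα⟩ := IsAlgClosed.exists_root (Polynomial.X ^ 2 -
        Polynomial.C (θ (X (Sum.inl k))) * Polynomial.X + Polynomial.C (θ (c k)))
        (by rw [show Polynomial.degree _ = 2 by compute_degree!]; decide)
      exact ⟨α, by simpa [Polynomial.IsRoot] using hα⟩
    choose α hα using hroot
    let χ : MvPolynomial (ι ⊕ ι) K →ₐ[K] L := aeval (Sum.elim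
      (fun k => if k ∈ s then α k else θ (X (Sum.inl k)))
      fun k => if hk : k ∈ s then θ (X (Sum.inl k)) - α k else θ (X (Sum.inr ⟨k, hk⟩)))
    have hχres : ∀ k, χ (residual s B k) = θ (c k) := fun k => by
      simp only [hsum, c, map_sum, map_mul]
      refine Finset.sum_congr rfl fun j _ => ?_
      rw [← algebraMap_eq, ← algebraMap_eq, AlgHom.commutes, AlgHom.commutes]
      simp [χ, j.2]
    have hχ : ∀ p ∈ ideal s B, χ p = 0 := by
      have : ideal s B ≤ RingHom.ker χ := by
        refine Ideal.span_le.mpr ?_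
        rintro _ ⟨k, hk, rfl⟩
        have hk' : k ∈ s := hk
        simp only [SetLike.mem_coe, RingHom.mem_ker, map_sub, map_mul, hχres]
        simp only [χ, aeval_X, Sum.elim_inl, Sum.elim_inr, hk', if_true, dif_pos]
        linear_combination - hα k
      exact this
    have hcomp : (Ideal.Quotient.liftₐ (ideal s B) χ hχ).comp ψ = θ := by
      refine MvPolynomial.algHom_ext fun x => ?_
      have hlift : ∀ p, Ideal.Quotient.liftₐ (ideal s B) χ hχ (π p) = χ p := fun p => rfl
      rcases x with k | j
      · by_cases hk : k ∈ s
        · rw [AlgHom.comp_apply, hψinl' k hk, map_add, hlift, hlift]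
          simp [χ, hk]
        · rw [AlgHom.comp_apply, hψinl k hk, hlift]
          simp [χ, hk]
      · rw [AlgHom.comp_apply, hψinr, hlift]
        simp [χ, j.2]
    have : Function.Injective ((Ideal.Quotient.liftₐ (ideal s B) χ hχ) ∘ ψ) := by
      rw [← AlgHom.coe_comp, hcomp]
      exact hθ
    exact this.of_comp
  rw [← ringKrullDim_eq_of_isIntegral_of_injective hinj,
    MvPolynomial.ringKrullDim_of_isNoetherianRing, ringKrullDim_eq_zero_of_field, zero_add,
    Nat.card_eq_fintype_card, Fintype.card_sum, Fintype.card_subtype_compl, Fintype.card_coe]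
  rfl


/-- If the columns of `A` selected by `σ` form an invertible matrix, then the ideal generated by
the moment map components of `A` is of the form `ideal s B` with `s` the range of `σ`. -/
theorem exists_span_range_eq_ideal {κ : Type*} [Fintype κ] [DecidableEq κ] (A : Matrix κ ι K)
    (σ : κ ↪ ι) (hσ : (A.submatrix id σ).det ≠ 0) (f : κ → MvPolynomial (ι ⊕ ι) K)
    (hf : ∀ i, f i = ∑ j, C (A i j) * X (Sum.inl j) * X (Sum.inr j)) :
    ∃ B, Ideal.span (Set.range f) = ideal (Finset.univ.map σ) B := by
  set S := A.submatrix id σ with hS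
  have hunit : IsUnit S.det := isUnit_iff_ne_zero.mpr hσ
  let G : Matrix κ ι K := S⁻¹ * A
  let B : ι → ι → K := fun k j => -∑ i, if σ i = k then G i j else 0
  let g : κ → MvPolynomial (ι ⊕ ι) K := fun i =>
    ∑ j, C (G i j) * X (Sum.inl j) * X (Sum.inr j)
  have hG : ∀ i i', G i (σ i') = (1 : Matrix κ κ K) i i' := fun i i' => by
    rw [← Matrix.nonsing_inv_mul S hunit]
    rfl
  have hB : ∀ i j, B (σ i) j = -G i j := fun i j => by simp [B, σ.injective.eq_iff]
  have hg : ∀ i, g i =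
      X (Sum.inl (σ i)) * X (Sum.inr (σ i)) - residual (Finset.univ.map σ) B (σ i) := by
    intro i
    simp only [g, residual, hB]
    rw [← Finset.sum_add_sum_compl (Finset.univ.map σ), Finset.sum_map]
    simp [hG, Matrix.one_apply, ite_mul, apply_ite C]
  have hideal : ideal (Finset.univ.map σ) B = Ideal.span (Set.range g) := by
    unfold ideal
    congr 1
    ext p
    simp [hg]
  refine ⟨B, hideal ▸ le_antisymm (Ideal.span_le.mpr ?_) (Ideal.span_le.mpr ?_)⟩
  · rintro _ ⟨l, rfl⟩
    have : f l = ∑ i, C (S l i) * g i := by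
      rw [← sum_mul_apply_mul_X_mul_X, Matrix.mul_nonsing_inv_cancel_left _ _ hunit, hf]
    rw [this]
    exact Ideal.sum_mem _ fun i _ => Ideal.mul_mem_left _ _ (Ideal.subset_span ⟨i, rfl⟩)
  · rintro _ ⟨i, rfl⟩
    have : g i = ∑ l, C (S⁻¹ i l) * f l := by
      simp only [hf]
      exact sum_mul_apply_mul_X_mul_X _ _ _
    rw [this]
    exact Ideal.sum_mem _ fun l _ => Ideal.mul_mem_left _ _ (Ideal.subset_span ⟨l, rfl⟩)

end HyperbolicIdeal


open MvPolynomial in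
/-- For a unimodular `d × n` integer matrix `A` of rank `d` such that deleting any single
column leaves a matrix of rank `d`, the quotient of `ℂ[z₁,…,zₙ,w₁,…,wₙ]` by the ideal
generated by the moment-map components `fᵢ = ∑ⱼ Aᵢⱼ zⱼ wⱼ` is an integral domain of Krull
dimension `2n - d`. -/
theorem momentMapFiber_isDomain_and_krullDim (d n : ℕ) (hdn : d ≤ n)
    (A : Matrix (Fin d) (Fin n) ℤ) (hrank : A.rank = d)
    (hunimod : ∀ σ : Fin d ↪ Fin n, (A.submatrix id ⇑σ).det ∈ ({-1, 0, 1} : Set ℤ))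
    (hdel : ∀ j₀ : Fin n,
      (A.submatrix id (fun k : {j : Fin n // j ≠ j₀} => (k : Fin n))).rank = d)
    (f : Fin d → MvPolynomial (Fin n ⊕ Fin n) ℂ)
    (hf : ∀ i, f i = ∑ j : Fin n,
      C ((A i j : ℤ) : ℂ) * X (Sum.inl j) * X (Sum.inr j)) :
    IsDomain (MvPolynomial (Fin n ⊕ Fin n) ℂ ⧸ Ideal.span (Set.range f)) ∧
    ringKrullDim (MvPolynomial (Fin n ⊕ Fin n) ℂ ⧸ Ideal.span (Set.range f)) =
      ((2 * n - d : ℕ) : WithBot (WithTop ℕ)) := by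
  have hdet : ∀ σ : Fin d ↪ Fin n, (A.submatrix id σ).det ≠ 0 →
      ((A.map (Int.castRingHom ℂ)).submatrix id σ).det ≠ 0 := by
    intro σ hσ
    rw [Matrix.submatrix_map, ← RingHom.mapMatrix_apply, ← RingHom.map_det]
    simpa using hσ
  have hspan : ∀ σ : Fin d ↪ Fin n, (A.submatrix id σ).det ≠ 0 →
      ∃ B, Ideal.span (Set.range f) = HyperbolicIdeal.ideal (Finset.univ.map σ) B :=
    fun σ hσ => HyperbolicIdeal.exists_span_range_eq_ideal _ σ (hdet σ hσ) f hf
  have hreg : ∀ k, Ideal.Quotient.mk (Ideal.span (Set.range f)) (X (Sum.inl k)) ∈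
      nonZeroDivisors (MvPolynomial (Fin n ⊕ Fin n) ℂ ⧸ Ideal.span (Set.range f)) := by
    intro k
    obtain ⟨τ, hτ⟩ := Matrix.exists_embedding_det_submatrix_ne_zero _ (hdel k)
    obtain ⟨B, hB⟩ := hspan (τ.trans (Function.Embedding.subtype _)) hτ
    rw [hB]
    refine HyperbolicIdeal.mk_X_inl_mem_nonZeroDivisors B ?_
    simp only [Finset.mem_map, Finset.mem_univ, true_and, not_exists]
    exact fun i => (τ i).2
  obtain ⟨σ, hσ⟩ := Matrix.exists_embedding_det_submatrix_ne_zero A hrank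
  obtain ⟨B, hB⟩ := hspan σ hσ
  rw [hB] at hreg ⊢
  refine ⟨?_, ?_⟩
  · have := HyperbolicIdeal.isPrime_ideal B fun k _ => hreg k
    infer_instance
  · rw [HyperbolicIdeal.ringKrullDim_quotient_ideal, Finset.card_map, Fintype.card_fin,
      Finset.card_univ, Fintype.card_fin, ← Nat.add_sub_assoc hdn, two_mul]
end

section
/- Let $d \le n$ and let $A = [a_1,\dots,a_n]$ be a $d \times n$ integer matrix of rank $d$ such that every $d \times d$ minor of $A$ lies in $\{-1,0,1\}$ (unimodularity) and such that for every index $j$, the matrix obtained from $A$ by deleting the $j$-th column still has rank $d$. Let $f_i = \sum_{j=1}^n A_{ij}\, z_j w_j$ for $i = 1,\dots,d$. Then the integral domain $\mathbb{C}[z_1,\dots,z_n,w_1,\dots,w_n]/(f_1,\dots,f_d)$ is integrally closed in its field of fractions (i.e., the affine variety $\mu^{-1}(0)$ is normal). -/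
theorem exists_mul_eq_of_isIntegral {A B K : Type*} [CommRing A] [IsDomain A] [CommRing B]
    [IsDomain B] [IsIntegrallyClosed B] [Field K] [Algebra A K] [IsFractionRing A K]
    (φ : A →+* B) (hφ : Function.Injective φ) {u : K} (hu : IsIntegral A u) {a b : A}
    (hab : u * algebraMap A K b = algebraMap A K a) : ∃ c : B, φ a = φ b * c := by
  let := φ.toAlgebra
  have hinj : Function.Injective (algebraMap A (FractionRing B)) := by
    rw [IsScalarTower.algebraMap_eq A B (FractionRing B)]
    exact (IsFractionRing.injective B (FractionRing B)).comp hφ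
  let ψ : K →ₐ[A] FractionRing B := IsFractionRing.liftAlgHom (g := Algebra.ofId A _) hinj
  obtain ⟨c, hc⟩ := IsIntegrallyClosed.isIntegral_iff.mp ((hu.map ψ).tower_top (A := B))
  refine ⟨c, IsFractionRing.injective B (FractionRing B) ?_⟩
  have h := congrArg ψ hab
  rw [map_mul, AlgHom.commutes, AlgHom.commutes, ← hc,
    IsScalarTower.algebraMap_apply A B (FractionRing B),
    IsScalarTower.algebraMap_apply A B (FractionRing B)] at h
  rw [map_mul, mul_comm]
  exact h.symm

/-- An integral domain is integrally closed as soon as every integral fraction `a / b` is in it. -/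
theorem isIntegrallyClosed_of_forall_dvd {A : Type*} [CommRing A] [IsDomain A]
    (h : ∀ (u : FractionRing A) (a b : A), IsIntegral A u → b ≠ 0 →
      u * algebraMap A _ b = algebraMap A _ a → b ∣ a) : IsIntegrallyClosed A := by
  rw [isIntegrallyClosed_iff (FractionRing A)]
  intro u hu
  obtain ⟨a, b, hb, rfl⟩ := IsFractionRing.div_surjective (A := A) u
  have hb0 : b ≠ 0 := nonZeroDivisors.ne_zero hb
  have hb' : algebraMap A (FractionRing A) b ≠ 0 := by simpa using hb0
  obtain ⟨c, rfl⟩ := h _ a b hu hb0 (div_mul_cancel₀ _ hb')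
  exact ⟨c, by rw [map_mul]; field_simp⟩

/-- A retract of an integrally closed domain is an integrally closed domain. -/
theorem isDomain_and_isIntegrallyClosed_of_retract {A B : Type*} [CommRing A] [CommRing B]
    [IsDomain B] [IsIntegrallyClosed B] (φ : A →+* B) (ρ : B →+* A)
    (h : ρ.comp φ = RingHom.id A) : IsDomain A ∧ IsIntegrallyClosed A := by
  have hl : ∀ a, ρ (φ a) = a := fun a => RingHom.congr_fun h a
  have hφ : Function.Injective φ := Function.LeftInverse.injective hl
  have : IsDomain A := hφ.isDomain φ
  refine ⟨this, isIntegrallyClosed_of_forall_dvd fun u a b hu _ hab => ?_⟩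
  obtain ⟨c, hc⟩ := exists_mul_eq_of_isIntegral φ hφ hu hab
  exact ⟨ρ c, by rw [← hl a, hc, map_mul, hl]⟩

theorem exists_pow_mul_eq_of_isIntegral {A : Type*} [CommRing A] [IsDomain A] {x : A}
    (hx : x ≠ 0) (h : IsIntegrallyClosed (Localization.Away x)) {u : FractionRing A}
    (hu : IsIntegral A u) {a b : A} (hab : u * algebraMap A _ b = algebraMap A _ a) :
    ∃ (m : ℕ) (c : A), x ^ m * a = b * c := by
  have hle : Submonoid.powers x ≤ nonZeroDivisors A :=
    powers_le_nonZeroDivisors_of_noZeroDivisors hx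
  have hinj := IsLocalization.injective (Localization.Away x) hle
  have : IsDomain (Localization.Away x) := IsLocalization.isDomain_localization hle
  obtain ⟨c, hc⟩ := exists_mul_eq_of_isIntegral _ hinj hu hab
  obtain ⟨⟨c', _, m, rfl⟩, hc'⟩ := IsLocalization.surj (Submonoid.powers x) c
  refine ⟨m, c', hinj ?_⟩
  simp only [map_mul, hc, ← hc']
  ring

theorem dvd_of_pow_dvd_pow_mul {A : Type*} [CommRing A] {x y : A} (hx : x ∈ nonZeroDivisors A)
    (hxy : ∀ p, x ∣ y * p → x ∣ p) (m k : ℕ) (p : A) (h : x ^ m ∣ y ^ k * p) : x ^ m ∣ p := by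
  have hk : ∀ (k : ℕ) (p : A), x ∣ y ^ k * p → x ∣ p := by
    intro k
    induction k with
    | zero => simp
    | succ k ih => exact fun p hp => hxy p (ih _ (by rwa [pow_succ, mul_assoc] at hp))
  induction m generalizing p with
  | zero => simp
  | succ m ih =>
    obtain ⟨q, rfl⟩ := hk k p ((dvd_pow_self x m.succ_ne_zero).trans h)
    obtain ⟨r, hr⟩ := h
    have : y ^ k * q = x ^ m * r :=
      (mul_cancel_left_mem_nonZeroDivisors hx).mp
        (by rw [← mul_assoc, mul_comm x, mul_assoc, hr]; ring)
    rw [pow_succ']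
    exact mul_dvd_mul_left x (ih q ⟨r, this⟩)

/-- If `x`, `y` is a regular sequence (and `y` is regular), then being an integrally closed domain
can be checked after inverting `x` and after inverting `y`. -/
theorem isDomain_and_isIntegrallyClosed_of_away {A : Type*} [CommRing A] {x y : A}
    (hx : x ∈ nonZeroDivisors A) (hy : y ∈ nonZeroDivisors A) (hxy : ∀ p, x ∣ y * p → x ∣ p)
    (hAx : IsDomain (Localization.Away x) ∧ IsIntegrallyClosed (Localization.Away x))
    (hAy : IsIntegrallyClosed (Localization.Away y)) :
    IsDomain A ∧ IsIntegrallyClosed A := by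
  obtain ⟨hd, hAx⟩ := hAx
  have : IsDomain A := (IsLocalization.injective (Localization.Away x)
    (Submonoid.powers_le.mpr hx)).isDomain (algebraMap A _)
  refine ⟨this, isIntegrallyClosed_of_forall_dvd fun u a b hu hb hab => ?_⟩
  obtain ⟨m, c, hc⟩ := exists_pow_mul_eq_of_isIntegral (nonZeroDivisors.ne_zero hx) hAx hu hab
  obtain ⟨k, e, he⟩ := exists_pow_mul_eq_of_isIntegral (nonZeroDivisors.ne_zero hy) hAy hu hab
  have h : y ^ k * c = x ^ m * e :=
    mul_left_cancel₀ hb (by linear_combination x ^ m * he - y ^ k * hc)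
  obtain ⟨r, rfl⟩ := dvd_of_pow_dvd_pow_mul hx hxy m k c ⟨e, h⟩
  exact ⟨r, mul_left_cancel₀ (pow_ne_zero m (nonZeroDivisors.ne_zero hx)) (by rw [hc]; ring)⟩

theorem Matrix.eq_zero_of_vecMul_intCast_eq_zero {K m n : Type*} [Field K] [CharZero K] [Fintype m]
    [Fintype n] (B : Matrix m n ℤ) (hB : B.rank = Fintype.card m) {c : m → K}
    (hc : ∀ k, ∑ i, c i * (B i k : K) = 0) : c = 0 := by
  classical
  have hq : Module.finrank ℤ ((m → ℤ) ⧸ LinearMap.range B.mulVecLin) = 0 := by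
    have := Submodule.finrank_quotient_add_finrank (LinearMap.range B.mulVecLin)
    rw [Module.finrank_fintype_fun_eq_card, ← hB, Matrix.rank] at this
    omega
  funext i
  rw [Module.finrank_eq_zero_iff] at hq
  obtain ⟨N, hN, h⟩ := hq (Submodule.Quotient.mk (Pi.single i 1))
  rw [← Submodule.Quotient.mk_smul, Submodule.Quotient.mk_eq_zero] at h
  obtain ⟨v, hv⟩ := h
  have hv' : ∀ l, ((∑ k, B l k * v k : ℤ) : K) = if l = i then (N : K) else 0 := by
    intro l
    have := congrFun hv l
    simp only [Matrix.mulVecLin_apply, Matrix.mulVec, dotProduct] at this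
    rw [this]
    simp [Pi.single_apply]
  have : (N : K) * c i = 0 := by
    calc (N : K) * c i = ∑ l, c l * ((∑ k, B l k * v k : ℤ) : K) := by
          simp [hv', mul_comm]
      _ = ∑ k, (∑ l, c l * (B l k : K)) * v k := by
          push_cast
          simp_rw [Finset.mul_sum, Finset.sum_mul]
          rw [Finset.sum_comm]
          simp_rw [mul_assoc]
      _ = 0 := by simp [hc]
  simpa [hN] using this

namespace MvPolynomial

theorem divMonomial_mul_of_mem_supported {σ R : Type*} [CommRing R] {m : σ →₀ ℕ}
    {p : MvPolynomial σ R} (hp : p ∈ supported R {k | m k = 0}) (q : MvPolynomial σ R) :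
    (p * q).divMonomial m = p * (q.divMonomial m) := by
  classical
  rw [supported] at hp
  induction hp using Algebra.adjoin_induction generalizing q with
  | mem x hx =>
    obtain ⟨k, hk, rfl⟩ := hx
    have hk : m k = 0 := hk
    ext e
    rw [coeff_divMonomial, coeff_X_mul', coeff_X_mul', coeff_divMonomial]
    simp only [Finsupp.mem_support_iff, Finsupp.add_apply, hk, zero_add]
    split_ifs with h
    · congr 1
      ext i
      by_cases hi : i = k
      · subst hi; simp [hk]
      · simp [Ne.symm hi]
    · rfl
  | algebraMap r =>
    ext e
    simp [algebraMap_eq, coeff_divMonomial, coeff_C_mul]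
  | add x y _ _ hx hy => rw [add_mul, add_divMonomial, hx, hy, add_mul]
  | mul x y _ _ hx hy => rw [mul_assoc, hx, hy, mul_assoc]

theorem divMonomial_mem_span {σ R : Type*} [CommRing R] {m : σ →₀ ℕ}
    {G : Set (MvPolynomial σ R)} (hG : ∀ p ∈ G, p ∈ supported R {k | m k = 0})
    {q : MvPolynomial σ R} (hq : q ∈ Ideal.span G) : q.divMonomial m ∈ Ideal.span G := by
  suffices ∀ a, (a * q).divMonomial m ∈ Ideal.span G by simpa using this 1
  induction hq using Submodule.span_induction with
  | mem x hx =>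
    intro a
    rw [mul_comm, divMonomial_mul_of_mem_supported (hG x hx)]
    exact Ideal.mul_mem_right _ _ (Ideal.subset_span hx)
  | zero => simp
  | add x y _ _ hx hy =>
    intro a
    rw [mul_add, add_divMonomial]
    exact add_mem (hx a) (hy a)
  | smul b x _ hx =>
    intro a
    rw [smul_eq_mul, ← mul_assoc]
    exact hx _

theorem divMonomial_eq_zero_of_totalDegree_lt {σ R : Type*} [CommRing R] {m : σ →₀ ℕ}
    {q : MvPolynomial σ R} (h : q.totalDegree < m.degree) : q.divMonomial m = 0 := by
  ext e
  rw [coeff_divMonomial, coeff_zero]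
  apply coeff_eq_zero_of_totalDegree_lt
  refine h.trans_le ?_
  change m.degree ≤ (m + e).degree
  simp

/-- If neither `g` nor the generators in `G` involve the variables of the monomial `m`, then `m + g` is
a nonzerodivisor modulo the ideal generated by `G`. -/
theorem mem_span_of_monomial_add_mul_mem {σ R : Type*} [CommRing R] {m : σ →₀ ℕ} (hm : m ≠ 0)
    {G : Set (MvPolynomial σ R)} (hG : ∀ p ∈ G, p ∈ supported R {k | m k = 0})
    {g : MvPolynomial σ R} (hg : g ∈ supported R {k | m k = 0}) {q : MvPolynomial σ R}
    (h : (monomial m 1 + g) * q ∈ Ideal.span G) : q ∈ Ideal.span G := by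
  have hstep : ∀ n : ℕ, q.divMonomial (n • m) + g * (q.divMonomial ((n + 1) • m)) ∈ Ideal.span G := by
    intro n
    induction n with
    | zero =>
      have := divMonomial_mem_span hG h
      rw [add_mul, add_divMonomial, divMonomial_monomial_mul,
        divMonomial_mul_of_mem_supported hg] at this
      simpa [divMonomial_zero] using this
    | succ n ih =>
      have := divMonomial_mem_span hG ih
      rw [add_divMonomial, divMonomial_mul_of_mem_supported hg, ← divMonomial_add,
        ← divMonomial_add, ← succ_nsmul, ← succ_nsmul] at this
      exact this
  have hzero : q.divMonomial ((q.totalDegree + 1) • m) = 0 := by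
    apply divMonomial_eq_zero_of_totalDegree_lt
    have : 0 < m.degree := Nat.pos_of_ne_zero (by rwa [ne_eq, Finsupp.degree_eq_zero_iff])
    rw [map_nsmul, smul_eq_mul]
    nlinarith
  have hdesc : ∀ n : ℕ, q.divMonomial (n • m) ∈ Ideal.span G → q ∈ Ideal.span G := by
    intro n
    induction n with
    | zero => simp [divMonomial_zero]
    | succ n ih =>
      exact fun hn => ih ((Ideal.add_mem_iff_left _ (Ideal.mul_mem_left _ g hn)).mp (hstep n))
  exact hdesc _ (hzero ▸ zero_mem _)

theorem mem_span_of_X_mul_mem {σ R : Type*} [CommRing R] {t : σ}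
    {G : Set (MvPolynomial σ R)} (hG : ∀ p ∈ G, p ∈ supported R {t}ᶜ) {q : MvPolynomial σ R}
    (h : X t * q ∈ Ideal.span G) : q ∈ Ideal.span G := by
  classical
  have hs : {k | (Finsupp.single t 1 : σ →₀ ℕ) k = 0} = {t}ᶜ := by
    ext k; simp [Finsupp.single_apply, eq_comm]
  have := divMonomial_mem_span (m := Finsupp.single t 1) (by rwa [hs]) h
  rwa [X_mul_divMonomial] at this

end MvPolynomial

namespace MvPolynomial

section MomentMap

variable {ι K : Type*} [Field K]

/-- The vectors of `W` whose `k`-th coordinate vanishes (the contraction of `k`, seen as a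
subspace of the same ambient space). -/
def vanishingAt (W : Submodule K (ι → K)) (k : ι) : Submodule K (ι → K) :=
  W ⊓ LinearMap.ker (LinearMap.proj (R := K) (φ := fun _ : ι => K) k)

theorem mem_vanishingAt {W : Submodule K (ι → K)} {k : ι} {v : ι → K} :
    v ∈ vanishingAt W k ↔ v ∈ W ∧ v k = 0 := by
  simp [vanishingAt]

theorem sub_smul_mem_vanishingAt {W : Submodule K (ι → K)} {k : ι} {v w : ι → K} (hv : v ∈ W)
    (hvk : v k = 1) (hw : w ∈ W) : w - w k • v ∈ vanishingAt W k :=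
  mem_vanishingAt.mpr ⟨sub_mem hw (W.smul_mem _ hv), by simp [hvk]⟩

/-- The index `j` of either of the variables `z j`, `w j`. -/
abbrev pairIndex (s : ι ⊕ ι) : ι := Sum.elim id id s

variable [Fintype ι]

/-- The quadric `∑ j, v j * z j * w j`, where `z j = X (inl j)` and `w j = X (inr j)`. -/
noncomputable def pairingQuadric (v : ι → K) : MvPolynomial (ι ⊕ ι) K :=
  ∑ j, C (v j) * X (Sum.inl j) * X (Sum.inr j)

/-- The ideal generated by the quadrics `∑ j, v j * z j * w j` for `v` in the subspace `W`. -/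
noncomputable def momentIdeal (W : Submodule K (ι → K)) : Ideal (MvPolynomial (ι ⊕ ι) K) :=
  Ideal.span (pairingQuadric '' W)

theorem pairingQuadric_add (v w : ι → K) :
    pairingQuadric (v + w) = pairingQuadric v + pairingQuadric w := by
  simp [pairingQuadric, add_mul, Finset.sum_add_distrib]

theorem pairingQuadric_smul (a : K) (v : ι → K) :
    pairingQuadric (a • v) = C a * pairingQuadric v := by
  simp [pairingQuadric, Finset.mul_sum, mul_assoc]

@[simp]
theorem pairingQuadric_zero : pairingQuadric (0 : ι → K) = 0 := by
  simp [pairingQuadric]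

theorem pairingQuadric_mem_supported {v : ι → K} {S : Set (ι ⊕ ι)}
    (h : ∀ j, v j ≠ 0 → Sum.inl j ∈ S ∧ Sum.inr j ∈ S) :
    pairingQuadric v ∈ supported K S := by
  refine sum_mem fun j _ => ?_
  by_cases hj : v j = 0
  · simp [hj]
  · have := h j hj
    exact mul_mem (mul_mem (Subalgebra.algebraMap_mem _ _) (X_mem_supported.mpr this.1))
      (X_mem_supported.mpr this.2)

theorem pairingQuadric_mem_momentIdeal {W : Submodule K (ι → K)} {v : ι → K} (hv : v ∈ W) :
    pairingQuadric v ∈ momentIdeal W :=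
  Ideal.subset_span ⟨v, hv, rfl⟩

theorem momentIdeal_mono {W₁ W₂ : Submodule K (ι → K)} (h : W₁ ≤ W₂) :
    momentIdeal W₁ ≤ momentIdeal W₂ :=
  Ideal.span_mono (Set.image_mono h)

theorem momentIdeal_span_range {m : Type*} (a : m → ι → K) :
    momentIdeal (Submodule.span K (Set.range a)) =
      Ideal.span (Set.range fun i => pairingQuadric (a i)) := by
  apply le_antisymm
  · rw [momentIdeal, Ideal.span_le]
    rintro _ ⟨v, hv, rfl⟩
    induction hv using Submodule.span_induction with
    | mem x hx =>
      obtain ⟨i, rfl⟩ := hx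
      exact Ideal.subset_span ⟨i, rfl⟩
    | zero => simp
    | add x y _ _ hx hy => rw [pairingQuadric_add]; exact add_mem hx hy
    | smul b x _ hx => rw [pairingQuadric_smul]; exact Ideal.mul_mem_left _ _ hx
  · rw [Ideal.span_le]
    rintro _ ⟨i, rfl⟩
    exact pairingQuadric_mem_momentIdeal (Submodule.subset_span ⟨i, rfl⟩)

theorem finrank_vanishingAt_lt {W : Submodule K (ι → K)} {k : ι} {v : ι → K} (hv : v ∈ W)
    (hvk : v k ≠ 0) : Module.finrank K (vanishingAt W k) < Module.finrank K W := by
  apply Submodule.finrank_lt_finrank_of_lt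
  refine lt_of_le_of_ne inf_le_left fun h => hvk ?_
  rw [← h] at hv
  exact (mem_vanishingAt.mp hv).2

theorem momentIdeal_eq_sup {W : Submodule K (ι → K)} {k : ι} {v : ι → K} (hv : v ∈ W)
    (hvk : v k = 1) :
    momentIdeal W = Ideal.span {pairingQuadric v} ⊔ momentIdeal (vanishingAt W k) := by
  apply le_antisymm
  · rw [momentIdeal, Ideal.span_le]
    rintro _ ⟨w, hw, rfl⟩
    have : w = w k • v + (w - w k • v) := by simp
    rw [this, pairingQuadric_add, pairingQuadric_smul]
    exact Submodule.add_mem_sup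
      (Ideal.mul_mem_left _ _ (Ideal.mem_span_singleton_self _))
      (pairingQuadric_mem_momentIdeal (sub_smul_mem_vanishingAt hv hvk hw))
  · rw [sup_le_iff, Ideal.span_singleton_le_iff_mem]
    exact ⟨pairingQuadric_mem_momentIdeal hv, momentIdeal_mono inf_le_left⟩

/-- The coordinate ring of the subscheme of affine space cut out by the quadrics
`∑ j, v j * z j * w j` for `v` in `W`. -/
abbrev MomentFiber (W : Submodule K (ι → K)) : Type _ :=
  MvPolynomial (ι ⊕ ι) K ⧸ momentIdeal W

variable [DecidableEq ι]

theorem pairingQuadric_eq_add_update (v : ι → K) (k : ι) :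
    pairingQuadric v =
      C (v k) * X (Sum.inl k) * X (Sum.inr k) + pairingQuadric (Function.update v k 0) := by
  rw [pairingQuadric, pairingQuadric, ← Finset.add_sum_erase _ _ (Finset.mem_univ k),
    ← Finset.add_sum_erase Finset.univ (fun j => C (Function.update v k 0 j) * _ * _)
      (Finset.mem_univ k)]
  simp only [Function.update_self, map_zero, zero_mul, zero_add]
  congr 1
  refine Finset.sum_congr rfl fun j hj => ?_
  rw [Function.update_of_ne (Finset.ne_of_mem_erase hj)]

theorem exists_apply_eq_one_of_single_notMem {W : Submodule K (ι → K)} {j : ι} (hW : W ≠ ⊥)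
    (hj : Pi.single j 1 ∉ W) : ∃ v ∈ W, ∃ k, k ≠ j ∧ v k = 1 := by
  obtain ⟨v, hv, hv0⟩ := Submodule.exists_mem_ne_zero_of_ne_bot hW
  by_cases h : ∃ k, k ≠ j ∧ v k ≠ 0
  · obtain ⟨k, hk, hvk⟩ := h
    exact ⟨(v k)⁻¹ • v, W.smul_mem _ hv, k, hk, by simp [hvk]⟩
  · push Not at h
    have hvj : v = v j • Pi.single j 1 := by
      ext k
      by_cases hk : k = j
      · subst hk; simp
      · simp [h k hk, hk]
    have hvj0 : v j ≠ 0 := fun h0 => hv0 (by rw [hvj, h0, zero_smul])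
    refine absurd ?_ hj
    rw [hvj] at hv
    exact (W.smul_mem_iff hvj0).mp hv

/-- A variable `z j` or `w j` is a nonzerodivisor modulo `momentIdeal W` unless `W` contains the
`j`-th coordinate vector. -/
theorem mem_momentIdeal_of_X_mul_mem (W : Submodule K (ι → K)) (s : ι ⊕ ι)
    (hs : Pi.single (pairIndex s) 1 ∉ W) (p : MvPolynomial (ι ⊕ ι) K)
    (hp : X s * p ∈ momentIdeal W) : p ∈ momentIdeal W := by
  induction hd : Module.finrank K W using Nat.strong_induction_on generalizing W p with
  | _ d ih =>
  by_cases hW : W = ⊥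
  · subst hW
    simp only [momentIdeal, Submodule.bot_coe, Set.image_singleton, pairingQuadric_zero,
      Ideal.span_singleton_eq_bot.mpr, Ideal.mem_bot] at hp ⊢
    simpa using hp
  obtain ⟨v, hv, k, hk, hvk⟩ := exists_apply_eq_one_of_single_notMem hW hs
  have hlt := finrank_vanishingAt_lt hv (k := k) (by simp [hvk])
  have hIH := fun p hp => ih _ (hd ▸ hlt) (vanishingAt W k)
    (fun h => hs (mem_vanishingAt.mp h).1) p hp rfl
  rw [momentIdeal_eq_sup hv hvk] at hp ⊢
  obtain ⟨q, r, hr, hqr⟩ := Ideal.mem_span_singleton_sup.mp hp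
  let m : ι ⊕ ι →₀ ℕ := Finsupp.single (Sum.inl k) 1 + Finsupp.single (Sum.inr k) 1
  have hmk : ∀ j, j ≠ k → m (Sum.inl j) = 0 ∧ m (Sum.inr j) = 0 := by
    intro j hj
    simp [m, hj.symm]
  have hm : m ≠ 0 := by
    intro h
    simpa [m] using DFunLike.congr_fun h (Sum.inl k)
  have hJ : Ideal.span (insert (X s) (pairingQuadric '' (vanishingAt W k : Set (ι → K)))) =
      Ideal.span {X s} ⊔ momentIdeal (vanishingAt W k) := by
    rw [Set.insert_eq, Ideal.span_union, momentIdeal]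
  have hq : q ∈ Ideal.span (insert (X s) (pairingQuadric '' (vanishingAt W k : Set (ι → K)))) := by
    refine mem_span_of_monomial_add_mul_mem (m := m) hm ?_
      (g := pairingQuadric (Function.update v k 0)) ?_ ?_
    · rintro _ (rfl | ⟨w, hw, rfl⟩)
      · refine X_mem_supported.mpr ?_
        rcases s with j | j
        · exact (hmk j hk.symm).1
        · exact (hmk j hk.symm).2
      · refine pairingQuadric_mem_supported fun j hj => hmk j ?_
        rintro rfl
        exact hj (mem_vanishingAt.mp hw).2
    · refine pairingQuadric_mem_supported fun j hj => hmk j ?_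
      rintro rfl
      simp at hj
    · have h1 : (monomial m (1 : K)) + pairingQuadric (Function.update v k 0) =
          pairingQuadric v := by
        rw [pairingQuadric_eq_add_update v k, hvk, C_1, one_mul, X, X, monomial_mul, one_mul]
      rw [h1, hJ, show pairingQuadric v * q = X s * p - r by rw [← hqr]; ring]
      exact sub_mem (Ideal.mem_sup_left (Ideal.mul_mem_right _ _ (Ideal.mem_span_singleton_self _)))
        (Ideal.mem_sup_right hr)
  rw [hJ] at hq
  obtain ⟨q', r', hr', rfl⟩ := Ideal.mem_span_singleton_sup.mp hq
  have hmem : p - pairingQuadric v * q' ∈ momentIdeal (vanishingAt W k) := by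
    apply hIH
    have : X s * (p - pairingQuadric v * q') = r + pairingQuadric v * r' := by
      linear_combination -hqr
    rw [this]
    exact add_mem hr (Ideal.mul_mem_left _ _ hr')
  rw [Ideal.mem_span_singleton_sup]
  exact ⟨q', _, hmem, by ring⟩

theorem mem_sup_of_X_swap_mul_mem (W : Submodule K (ι → K)) (s : ι ⊕ ι)
    {p : MvPolynomial (ι ⊕ ι) K}
    (hp : X s.swap * p ∈ Ideal.span {X s} ⊔ momentIdeal W) :
    p ∈ Ideal.span {X s} ⊔ momentIdeal W := by
  let j := pairIndex s
  have hsplit : ∀ v : ι → K, ∃ q, pairingQuadric v =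
      q * X s + pairingQuadric (Function.update v j 0) := by
    intro v
    refine ⟨C (v j) * X s.swap, ?_⟩
    rw [pairingQuadric_eq_add_update v j]
    rcases s with i | i
    · simp [j]; ring
    · simp [j]
  have hJ : Ideal.span {X s} ⊔ momentIdeal W = Ideal.span
      (insert (X s) ((fun v => pairingQuadric (Function.update v j 0)) '' (W : Set (ι → K)))) := by
    rw [Set.insert_eq, Ideal.span_union]
    apply le_antisymm
    · refine sup_le le_sup_left ?_
      rw [momentIdeal, Ideal.span_le]
      rintro _ ⟨v, hv, rfl⟩
      obtain ⟨q, hq⟩ := hsplit v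
      rw [hq]
      exact Submodule.add_mem_sup (Ideal.mul_mem_left _ _ (Ideal.mem_span_singleton_self _))
        (Ideal.subset_span ⟨v, hv, rfl⟩)
    · refine sup_le le_sup_left ?_
      rw [Ideal.span_le]
      rintro _ ⟨v, hv, rfl⟩
      obtain ⟨q, hq⟩ := hsplit v
      change pairingQuadric (Function.update v j 0) ∈ _
      rw [← sub_eq_iff_eq_add'.mpr hq]
      exact sub_mem (Ideal.mem_sup_right (pairingQuadric_mem_momentIdeal hv))
        (Ideal.mem_sup_left (Ideal.mul_mem_left _ _ (Ideal.mem_span_singleton_self _)))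
  rw [hJ] at hp ⊢
  refine mem_span_of_X_mul_mem ?_ hp
  rintro _ (rfl | ⟨v, -, rfl⟩)
  · refine X_mem_supported.mpr ?_
    rcases s with i | i <;> simp
  · refine pairingQuadric_mem_supported fun i hi => ?_
    have hij : i ≠ j := by
      rintro rfl
      simp at hi
    rcases s with l | l <;> simpa [j] using hij

theorem mk_X_mem_nonZeroDivisors {W : Submodule K (ι → K)} {s : ι ⊕ ι}
    (hs : Pi.single (pairIndex s) 1 ∉ W) :
    Ideal.Quotient.mk (momentIdeal W) (X s) ∈ nonZeroDivisors (MomentFiber W) := by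
  rw [mem_nonZeroDivisors_iff_left]
  intro p hp
  obtain ⟨p, rfl⟩ := Ideal.Quotient.mk_surjective p
  rw [← map_mul, Ideal.Quotient.eq_zero_iff_mem] at hp
  exact Ideal.Quotient.eq_zero_iff_mem.mpr (mem_momentIdeal_of_X_mul_mem W s hs p hp)

theorem mk_X_dvd_of_dvd_swap_mul {W : Submodule K (ι → K)} {s : ι ⊕ ι} (p : MomentFiber W)
    (hp : Ideal.Quotient.mk (momentIdeal W) (X s) ∣
      Ideal.Quotient.mk (momentIdeal W) (X s.swap) * p) :
    Ideal.Quotient.mk (momentIdeal W) (X s) ∣ p := by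
  obtain ⟨p, rfl⟩ := Ideal.Quotient.mk_surjective p
  have key : ∀ q, Ideal.Quotient.mk (momentIdeal W) (X s) ∣ Ideal.Quotient.mk (momentIdeal W) q ↔
      q ∈ Ideal.span {X s} ⊔ momentIdeal W := by
    intro q
    rw [Ideal.mem_span_singleton_sup]
    constructor
    · rintro ⟨c, hc⟩
      obtain ⟨c, rfl⟩ := Ideal.Quotient.mk_surjective c
      rw [← map_mul, Ideal.Quotient.mk_eq_mk_iff_sub_mem] at hc
      exact ⟨c, _, hc, by ring⟩
    · rintro ⟨c, r, hr, rfl⟩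
      rw [map_add, Ideal.Quotient.eq_zero_iff_mem.mpr hr, add_zero, map_mul]
      exact dvd_mul_left _ _
  rw [← map_mul, key] at hp
  exact (key p).mpr (mem_sup_of_X_swap_mul_mem W s hp)

/-- Inverting `z j` (or `w j`) turns the fiber of `W` into a retract of the localized fiber of
`vanishingAt W j`, by solving for the partner variable. -/
theorem isDomain_and_isIntegrallyClosed_momentFiber_away {W : Submodule K (ι → K)} {s : ι ⊕ ι}
    {v : ι → K} (hv : v ∈ W) (hvs : v (pairIndex s) = 1)
    (hs : Pi.single (pairIndex s) 1 ∉ W)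
    (hd : IsDomain (MomentFiber (vanishingAt W (pairIndex s))))
    (hn : IsIntegrallyClosed (MomentFiber (vanishingAt W (pairIndex s)))) :
    IsDomain (Localization.Away (Ideal.Quotient.mk (momentIdeal W) (X s))) ∧
    IsIntegrallyClosed (Localization.Away (Ideal.Quotient.mk (momentIdeal W) (X s))) := by
  set j := pairIndex s with hj
  set W' := vanishingAt W j
  set x := Ideal.Quotient.mk (momentIdeal W) (X s)
  set x' := Ideal.Quotient.mk (momentIdeal W') (X s) with hx'
  set A := Localization.Away x
  set B := Localization.Away x'
  have hle : Submonoid.powers x' ≤ nonZeroDivisors (MomentFiber W') :=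
    Submonoid.powers_le.mpr (mk_X_mem_nonZeroDivisors fun h => hs (mem_vanishingAt.mp h).1)
  have : IsDomain B := IsLocalization.isDomain_localization hle
  have : IsIntegrallyClosed B := isIntegrallyClosed_of_isLocalization B (Submonoid.powers x') hle
  let ιB : MvPolynomial (ι ⊕ ι) K →ₐ[K] B :=
    (IsScalarTower.toAlgHom K (MomentFiber W') B).comp (Ideal.Quotient.mkₐ K (momentIdeal W'))
  let ιA : MvPolynomial (ι ⊕ ι) K →ₐ[K] A :=
    (IsScalarTower.toAlgHom K (MomentFiber W) A).comp (Ideal.Quotient.mkₐ K (momentIdeal W))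
  have hιA : ∀ p ∈ momentIdeal W, ιA p = 0 := by
    intro p hp
    change algebraMap (MomentFiber W) A (Ideal.Quotient.mk _ p) = 0
    rw [Ideal.Quotient.eq_zero_iff_mem.mpr hp, map_zero]
  have hιB : ∀ p ∈ momentIdeal W', ιB p = 0 := by
    intro p hp
    change algebraMap (MomentFiber W') B (Ideal.Quotient.mk _ p) = 0
    rw [Ideal.Quotient.eq_zero_iff_mem.mpr hp, map_zero]
  have huA : IsUnit (ιA (X s)) := IsLocalization.Away.algebraMap_isUnit x
  obtain ⟨u, hu⟩ : ∃ u, ιB (X s) * u = 1 :=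
    (IsLocalization.Away.algebraMap_isUnit (S := B) x').exists_right_inv
  set g := pairingQuadric (Function.update v j 0)
  -- `z` is kept and its partner `w` is replaced by `-g / z`.
  let φ₀ : MvPolynomial (ι ⊕ ι) K →ₐ[K] B :=
    aeval (Function.update (fun r => ιB (X r)) s.swap (-(u * ιB g)))
  have hφX : ∀ r, r ≠ s.swap → φ₀ (X r) = ιB (X r) := by
    intro r hr
    simp [φ₀, Function.update_of_ne hr]
  have hswap : φ₀ (X s.swap) = -(u * ιB g) := by simp [φ₀]
  have hsne : s ≠ s.swap := by rcases s with i | i <;> simp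
  have hφupd : ∀ w : ι → K, w j = 0 → φ₀ (pairingQuadric w) = ιB (pairingQuadric w) := by
    intro w hw
    simp only [pairingQuadric, map_sum, map_mul]
    refine Finset.sum_congr rfl fun i _ => ?_
    by_cases hi : i = j
    · subst hi; simp [hw]
    · rw [hφX, hφX, ← algebraMap_eq, AlgHom.commutes, AlgHom.commutes]
      all_goals
        rcases s with l | l <;> simp [j] at hi ⊢
        try exact hi
  have hquad : pairingQuadric v = X s * X s.swap + g := by
    rw [pairingQuadric_eq_add_update v j, hvs, C_1, one_mul]
    rcases s with i | i
    · rfl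
    · rw [mul_comm (X (Sum.inl _))]; rfl
  have hφ₀ : ∀ p ∈ momentIdeal W, φ₀ p = 0 := by
    suffices momentIdeal W ≤ RingHom.ker φ₀ from fun p hp => this hp
    rw [momentIdeal_eq_sup hv hvs, sup_le_iff, Ideal.span_singleton_le_iff_mem]
    constructor
    · rw [RingHom.mem_ker, hquad, map_add, map_mul, hφupd _ (by simp), hφX s hsne, hswap]
      linear_combination (-ιB g) * hu
    · refine Ideal.span_le.mpr ?_
      rintro _ ⟨w, hw, rfl⟩
      have hw' : w j = 0 := (mem_vanishingAt.mp hw).2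
      change φ₀ _ = 0
      rw [hφupd w hw']
      exact hιB _ (pairingQuadric_mem_momentIdeal hw)
  let φ₁ : MomentFiber W →+* B := Ideal.Quotient.lift _ φ₀.toRingHom hφ₀
  have hφ₁ : IsUnit (φ₁ x) := by
    change IsUnit (φ₀ (X s))
    rw [hφX s hsne]
    exact IsUnit.of_mul_eq_one _ hu
  let φ : A →+* B := IsLocalization.Away.lift x hφ₁
  let ρ₁ : MomentFiber W' →+* A := Ideal.Quotient.lift _ ιA.toRingHom
    fun p hp => hιA p (momentIdeal_mono inf_le_left hp)
  have hρ₁ : IsUnit (ρ₁ x') := huA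
  let ρ : B →+* A := IsLocalization.Away.lift x' hρ₁
  have hρB : ∀ p, ρ (ιB p) = ιA p := fun p => IsLocalization.Away.lift_eq x' hρ₁ _
  have hφA : ∀ p, φ (ιA p) = φ₀ p := fun p => IsLocalization.Away.lift_eq x hφ₁ _
  refine isDomain_and_isIntegrallyClosed_of_retract φ ρ ?_
  apply IsLocalization.ringHom_ext (Submonoid.powers x)
  apply Ideal.Quotient.ringHom_ext
  apply MvPolynomial.ringHom_ext
  · intro a
    change ρ (φ (ιA (C a))) = ιA (C a)
    rw [hφA, ← hρB, ← algebraMap_eq, AlgHom.commutes, AlgHom.commutes]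
  · intro r
    change ρ (φ (ιA (X r))) = ιA (X r)
    rw [hφA]
    by_cases hr : r = s.swap
    · subst hr
      apply huA.mul_left_cancel
      have h1 : ιA (X s) * ρ u = 1 := by rw [← hρB, ← map_mul, hu, map_one]
      have h2 := hιA _ (pairingQuadric_mem_momentIdeal hv)
      rw [hquad, map_add, map_mul] at h2
      rw [hswap, map_neg, map_mul, hρB]
      linear_combination (-ιA g) * h1 - h2
    · rw [hφX r hr, hρB]

/-- If the subspace `W` contains no coordinate vector (equivalently, the
matroid represented by `W` has no coloop), the fiber is an integrally closed domain. -/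
theorem isDomain_and_isIntegrallyClosed_momentFiber (W : Submodule K (ι → K))
    (hW : ∀ j, Pi.single j 1 ∉ W) :
    IsDomain (MomentFiber W) ∧ IsIntegrallyClosed (MomentFiber W) := by
  induction hd : Module.finrank K W using Nat.strong_induction_on generalizing W with
  | _ d ih =>
  by_cases h : W = ⊥
  · subst h
    have hbot : momentIdeal (⊥ : Submodule K (ι → K)) = ⊥ := by
      simp [momentIdeal]
    let e : MvPolynomial (ι ⊕ ι) K ≃+* MomentFiber (⊥ : Submodule K (ι → K)) :=
      (RingEquiv.quotientBot _).symm.trans (Ideal.quotEquivOfEq hbot.symm)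
    exact ⟨e.symm.injective.isDomain e.symm.toRingHom, IsIntegrallyClosed.of_equiv e⟩
  obtain ⟨v, hv, hv0⟩ := Submodule.exists_mem_ne_zero_of_ne_bot h
  obtain ⟨j, hvj⟩ := Function.ne_iff.mp hv0
  have hv' : (v j)⁻¹ • v ∈ W := W.smul_mem _ hv
  have hvj' : ((v j)⁻¹ • v) j = 1 := by simpa using inv_mul_cancel₀ hvj
  obtain ⟨h1, h2⟩ := ih _ (hd ▸ finrank_vanishingAt_lt hv hvj) (vanishingAt W j)
    (fun k hk => hW k (mem_vanishingAt.mp hk).1) rfl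
  exact isDomain_and_isIntegrallyClosed_of_away
    (mk_X_mem_nonZeroDivisors (s := Sum.inl j) (hW j))
    (mk_X_mem_nonZeroDivisors (s := Sum.inr j) (hW j))
    (mk_X_dvd_of_dvd_swap_mul (s := Sum.inl j))
    (isDomain_and_isIntegrallyClosed_momentFiber_away (s := Sum.inl j) hv' hvj' (hW j) h1 h2)
    (isDomain_and_isIntegrallyClosed_momentFiber_away (s := Sum.inr j) hv' hvj' (hW j) h1 h2).2

end MomentMap

end MvPolynomial

theorem Matrix.single_notMem_span_rows {K : Type*} [Field K] [CharZero K] {m n : Type*}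
    [Fintype m] [Fintype n] [DecidableEq n] (A : Matrix m n ℤ) (j : n)
    (hA : (A.submatrix id (fun k : {k : n // k ≠ j} => (k : n))).rank = Fintype.card m) :
    Pi.single j 1 ∉ Submodule.span K (Set.range fun i k => (A i k : K)) := by
  intro h
  obtain ⟨c, hc⟩ := (Submodule.mem_span_range_iff_exists_fun K).mp h
  have hc' : ∀ k, ∑ i, c i * (A i k : K) = (Pi.single j 1 : n → K) k := by
    intro k
    rw [← hc]
    simp
  have h0 := Matrix.eq_zero_of_vecMul_intCast_eq_zero _ hA (c := c) fun k => by
    simp [hc', k.2]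
  simpa [h0] using hc' j

open MvPolynomial in
/-- For a unimodular `d × n` integer matrix `A` of rank `d` such that deleting any single
column leaves a matrix of rank `d`, the integral domain
`ℂ[z₁,…,zₙ,w₁,…,wₙ]/(f₁,…,f_d)`, where `fᵢ = ∑ⱼ Aᵢⱼ zⱼ wⱼ`, is integrally closed in its
field of fractions; i.e. the moment-map fiber `μ⁻¹(0)` is normal. -/
theorem momentMapFiber_normal (d n : ℕ) (hdn : d ≤ n)
    (A : Matrix (Fin d) (Fin n) ℤ) (hrank : A.rank = d)
    (hunimod : ∀ σ : Fin d ↪ Fin n, (A.submatrix id ⇑σ).det ∈ ({-1, 0, 1} : Set ℤ))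
    (hdel : ∀ j₀ : Fin n,
      (A.submatrix id (fun k : {j : Fin n // j ≠ j₀} => (k : Fin n))).rank = d)
    (f : Fin d → MvPolynomial (Fin n ⊕ Fin n) ℂ)
    (hf : ∀ i, f i = ∑ j : Fin n,
      C ((A i j : ℤ) : ℂ) * X (Sum.inl j) * X (Sum.inr j)) :
    IsDomain (MvPolynomial (Fin n ⊕ Fin n) ℂ ⧸ Ideal.span (Set.range f)) ∧
    IsIntegrallyClosed (MvPolynomial (Fin n ⊕ Fin n) ℂ ⧸ Ideal.span (Set.range f)) := by
  let a : Fin d → Fin n → ℂ := fun i k => (A i k : ℂ)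
  have hspan : Ideal.span (Set.range f) = momentIdeal (Submodule.span ℂ (Set.range a)) := by
    rw [momentIdeal_span_range]
    congr 2
    funext i
    rw [hf i, pairingQuadric]
  rw [hspan]
  exact isDomain_and_isIntegrallyClosed_momentFiber _ fun j =>
    A.single_notMem_span_rows j (by rw [hdel j, Fintype.card_fin])
end

section
/- Let $d \le n$ and let $A = [a_1,\dots,a_n]$ be a $d \times n$ integer matrix of rank $d$ such that every $d \times d$ minor of $A$ lies in $\{-1,0,1\}$ (unimodularity) and such that for every index $j$, the matrix obtained from $A$ by deleting the $j$-th column still has rank $d$. Then the polynomials $f_i = \sum_{j=1}^n A_{ij}\, z_j w_j$, $i = 1,\dots,d$, form a regular sequence in $\mathbb{C}[z_1,\dots,z_n,w_1,\dots,w_n]$; in particular $\mu^{-1}(0)$ is a complete intersection. -/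
/-- An exponent vector on `ι ⊕ ι` is the same as a weight `b : ι → ℤ` together with the
componentwise minimum `u` of its two halves. -/
noncomputable def Equiv.weightProdMinEquiv (ι : Type*) [Finite ι] :
    ((ι → ℤ) × (ι →₀ ℕ)) ≃ (ι ⊕ ι →₀ ℕ) where
  toFun p := Finsupp.equivFunOnFinite.symm
    (Sum.elim (fun j => p.2 j + (p.1 j).toNat) (fun j => p.2 j + (-p.1 j).toNat))
  invFun m := (fun j => (m (Sum.inl j) : ℤ) - m (Sum.inr j),
    Finsupp.equivFunOnFinite.symm fun j => min (m (Sum.inl j)) (m (Sum.inr j)))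
  left_inv p := by
    refine Prod.ext (funext fun j => ?_) (Finsupp.ext fun j => ?_)
    · simp
    · simp; omega
  right_inv m := by
    ext (j | j) <;> simp <;> omega

namespace MvPolynomial

variable {ι R : Type*} [CommRing R]

/-- The map `u_j ↦ z_j w_j`. -/
noncomputable def mulPairs (ι R : Type*) [CommRing R] :
    MvPolynomial ι R →ₐ[R] MvPolynomial (ι ⊕ ι) R :=
  aeval fun j => X (Sum.inl j) * X (Sum.inr j)

lemma mulPairs_X (j : ι) :
    mulPairs ι R (X j) = X (Sum.inl j) * X (Sum.inr j) := by
  simp [mulPairs]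

lemma mulPairs_monomial_mul [Finite ι] (b : ι → ℤ) (u : ι →₀ ℕ) (c : R) :
    mulPairs ι R (monomial u c) * monomial (Equiv.weightProdMinEquiv ι (b, 0)) 1 =
      monomial (Equiv.weightProdMinEquiv ι (b, u)) c := by
  have : Fintype ι := Fintype.ofFinite ι
  have hu : mulPairs ι R (monomial u c) =
      monomial (Finsupp.equivFunOnFinite.symm (Sum.elim u u)) c := by
    rw [mulPairs, aeval_monomial, monomial_eq, Finsupp.prod_fintype _ _ (by simp),
      Finsupp.prod_fintype _ _ (by simp), Fintype.prod_sum_type]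
    simp [mul_pow, Finset.prod_mul_distrib, algebraMap_eq]
  rw [hu, monomial_mul, mul_one]
  congr 2
  refine Finsupp.ext fun j => ?_
  cases j <;> simp [Equiv.weightProdMinEquiv]

/-- `R[z, w]` is free over `R[u]` along `u_j ↦ z_j w_j`, hence flat. -/
lemma flat_mulPairs [Finite ι] : (mulPairs ι R).toRingHom.Flat := by
  algebraize [(mulPairs ι R).toRingHom]
  let g : ((ι → ℤ) →₀ MvPolynomial ι R) →ₗ[MvPolynomial ι R] MvPolynomial (ι ⊕ ι) R :=
    Finsupp.linearCombination _ fun b => monomial (Equiv.weightProdMinEquiv ι (b, 0)) 1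
  let e : ((ι → ℤ) →₀ MvPolynomial ι R) ≃+ MvPolynomial (ι ⊕ ι) R :=
    ((Finsupp.mapRange.addEquiv AddMonoidAlgebra.coeffAddEquiv).trans
      (Finsupp.curryAddEquiv.symm.trans
        (Finsupp.domCongr (Equiv.weightProdMinEquiv ι)))).trans
      AddMonoidAlgebra.coeffAddEquiv.symm
  have hge : g.toAddMonoidHom = e.toAddMonoidHom := by
    ext b u c : 3
    change g (Finsupp.single b (monomial u c)) = e (Finsupp.single b (monomial u c))
    have he : e (Finsupp.single b (monomial u c)) =
        monomial (Equiv.weightProdMinEquiv ι (b, u)) c := by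
      simp [e, monomial]
    rw [he, ← mulPairs_monomial_mul]
    exact Finsupp.linearCombination_single ..
  have hg : Function.Bijective g := by
    have : ⇑g = e := congrArg DFunLike.coe hge
    rw [this]
    exact e.bijective
  exact Module.Flat.of_linearEquiv (LinearEquiv.ofBijective g hg).symm

/-- Distinct variables form a weakly regular sequence. -/
lemma isWeaklyRegular_ofFn_X {σ : Type*} {d : ℕ} {v : Fin d → σ} (hv : Function.Injective v) :
    RingTheory.Sequence.IsWeaklyRegular (MvPolynomial σ R)
      (List.ofFn fun i => (X (v i) : MvPolynomial σ R)) := by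
  rw [RingTheory.Sequence.isWeaklyRegular_iff]
  intro i hi
  rw [List.length_ofFn] at hi
  have hI : (Ideal.ofList ((List.ofFn fun i => (X (v i) : MvPolynomial σ R)).take i) • ⊤ :
      Submodule (MvPolynomial σ R) (MvPolynomial σ R)) =
      Ideal.span (X '' (v '' {j | j.1 < i})) := by
    rw [smul_eq_mul, Ideal.mul_top, Ideal.ofList]
    congr 1
    ext p
    simp only [Set.mem_ofPred_eq, List.mem_take_iff_getElem, List.getElem_ofFn, Set.mem_image,
      exists_exists_and_eq_and, List.length_ofFn]
    constructor
    · rintro ⟨j, hj, rfl⟩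
      exact ⟨⟨j, by omega⟩, by simp; omega, rfl⟩
    · rintro ⟨j, hj, rfl⟩
      exact ⟨j, by omega, rfl⟩
  rw [hI, isSMulRegular_quotient_iff_mem_of_smul_mem]
  intro p hp
  rw [List.getElem_ofFn, smul_eq_mul] at hp
  rw [mem_ideal_span_X_image] at hp ⊢
  intro m hm
  obtain ⟨k, hk, hk0⟩ := hp (Finsupp.single (v ⟨i, hi⟩) 1 + m) (by
    rw [mem_support_iff] at hm ⊢
    rwa [coeff_X_mul])
  refine ⟨k, hk, ?_⟩
  obtain ⟨j, hj, rfl⟩ := hk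
  have hne : v ⟨i, hi⟩ ≠ v j := fun h => by
    obtain rfl := hv h
    exact lt_irrefl i hj
  simpa [Finsupp.single_eq_of_ne' hne] using hk0

/-- Linearly independent linear forms over a field form a weakly regular sequence. -/
lemma isWeaklyRegular_ofFn_linearForms {K : Type*} [Field K] [Fintype ι] {d : ℕ}
    {v : Fin d → ι → K} (hv : LinearIndependent K v) :
    RingTheory.Sequence.IsWeaklyRegular (MvPolynomial ι K)
      (List.ofFn fun i => ∑ j, C (v i j) * (X j : MvPolynomial ι K)) := by
  classical
  let b := Module.Basis.sumExtend hv
  let e := (SymmetricAlgebra.equivMvPolynomial b).symm.trans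
    (SymmetricAlgebra.equivMvPolynomial (Pi.basisFun K ι))
  have he (i : Fin d) : e (X (Sum.inl i)) = ∑ j, C (v i j) * (X j : MvPolynomial ι K) := by
    have hb : b (Sum.inl i) = ∑ j, v i j • Pi.basisFun K ι j := by
      have : b (Sum.inl i) = v i := by
        simp [b, Module.Basis.sumExtend]
        rfl
      rw [this]
      exact ((Pi.basisFun K ι).sum_repr (v i)).symm
    rw [AlgEquiv.trans_apply, SymmetricAlgebra.equivMvPolynomial_symm_X, hb, map_sum, map_sum]
    refine Finset.sum_congr rfl fun j _ => ?_
    rw [map_smul, map_smul, SymmetricAlgebra.equivMvPolynomial_ι_apply, smul_eq_C_mul]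
  have hflat : e.toAlgHom.toRingHom.Flat := .of_bijective (f := e.toAlgHom.toRingHom) e.bijective
  algebraize [e.toAlgHom.toRingHom]
  have h := (isWeaklyRegular_ofFn_X (R := K)
    (Sum.inl_injective (α := Fin d) (β := Module.Basis.sumExtendIndex hv))).of_flat
    (S := MvPolynomial ι K)
  rw [List.map_ofFn] at h
  exact (congrArg List.ofFn (_root_.funext he)) ▸ h

end MvPolynomial

/-- An integer matrix of full row rank has linearly independent rows over any field of
characteristic zero. -/
lemma Matrix.linearIndependent_intCast_row {m n K : Type*} [Fintype m] [Fintype n] [Field K]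
    [CharZero K] {A : Matrix m n ℤ} (hA : A.rank = Fintype.card m) :
    LinearIndependent K fun i j => (A i j : K) := by
  classical
  have hq : Module.finrank ℤ ((m → ℤ) ⧸ LinearMap.range A.mulVecLin) = 0 := by
    have := Submodule.finrank_quotient_add_finrank (LinearMap.range A.mulVecLin)
    rw [Module.finrank_fintype_fun_eq_card, ← hA, Matrix.rank] at this
    omega
  rw [Fintype.linearIndependent_iff]
  intro g hg i
  obtain ⟨a, ha, hai⟩ := Module.finrank_eq_zero_iff.mp hq
    (Submodule.Quotient.mk (Pi.single i 1))
  rw [← Submodule.Quotient.mk_smul, Submodule.Quotient.mk_eq_zero] at hai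
  obtain ⟨x, hx⟩ := hai
  have hx' (k : m) : ∑ j, (A k j : K) * x j = a * (Pi.single i 1 : m → K) k := by
    have := congrArg (Int.cast (R := K)) (congrFun hx k)
    simpa [Matrix.mulVec, dotProduct, Pi.single_apply] using this
  have hg' (j : n) : ∑ k, g k * (A k j : K) = 0 := by
    simpa using congrFun hg j
  have hsum : ∑ k, g k * ∑ j, (A k j : K) * x j = 0 := by
    simp_rw [Finset.mul_sum, ← mul_assoc]
    rw [Finset.sum_comm]
    simp [← Finset.sum_mul, hg']
  simp_rw [hx'] at hsum
  simpa [Pi.single_apply, ha] using hsum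


open MvPolynomial in
/-- For a unimodular `d × n` integer matrix `A` of rank `d` such that deleting any single
column leaves a matrix of rank `d`, the moment-map components `fᵢ = ∑ⱼ Aᵢⱼ zⱼ wⱼ`,
`i = 1,…,d`, form a regular sequence in `ℂ[z₁,…,zₙ,w₁,…,wₙ]`; in particular `μ⁻¹(0)` is a
complete intersection. -/
theorem momentMap_regularSequence (d n : ℕ) (hdn : d ≤ n)
    (A : Matrix (Fin d) (Fin n) ℤ) (hrank : A.rank = d)
    (hunimod : ∀ σ : Fin d ↪ Fin n, (A.submatrix id ⇑σ).det ∈ ({-1, 0, 1} : Set ℤ))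
    (hdel : ∀ j₀ : Fin n,
      (A.submatrix id (fun k : {j : Fin n // j ≠ j₀} => (k : Fin n))).rank = d)
    (f : Fin d → MvPolynomial (Fin n ⊕ Fin n) ℂ)
    (hf : ∀ i, f i = ∑ j : Fin n,
      C ((A i j : ℤ) : ℂ) * X (Sum.inl j) * X (Sum.inr j)) :
    RingTheory.Sequence.IsRegular (MvPolynomial (Fin n ⊕ Fin n) ℂ) (List.ofFn f) := by
  have hindep : LinearIndependent ℂ fun i j => (A i j : ℂ) :=
    Matrix.linearIndependent_intCast_row (by simpa using hrank)
  have hweak : RingTheory.Sequence.IsWeaklyRegular (MvPolynomial (Fin n ⊕ Fin n) ℂ)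
      (List.ofFn f) := by
    have hflat : (mulPairs (Fin n) ℂ).toRingHom.Flat := flat_mulPairs
    algebraize [(mulPairs (Fin n) ℂ).toRingHom]
    have h := (isWeaklyRegular_ofFn_linearForms hindep).of_flat
      (S := MvPolynomial (Fin n ⊕ Fin n) ℂ)
    rw [List.map_ofFn] at h
    have hmap (i : Fin d) :
        mulPairs (Fin n) ℂ (∑ j, C ((A i j : ℤ) : ℂ) * X j) = f i := by
      rw [hf, map_sum]
      refine Finset.sum_congr rfl fun j _ => ?_
      rw [map_mul, mulPairs_X, ← algebraMap_eq, ← algebraMap_eq, AlgHom.commutes, mul_assoc]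
    exact (congrArg List.ofFn (_root_.funext hmap)) ▸ h
  refine ⟨hweak, fun htop => ?_⟩
  have hle : Ideal.ofList (List.ofFn f) ≤
      RingHom.ker (constantCoeff : MvPolynomial (Fin n ⊕ Fin n) ℂ →+* ℂ) := by
    rw [Ideal.ofList, Ideal.span_le]
    intro p hp
    obtain ⟨i, rfl⟩ := List.mem_ofFn.mp hp
    simp [hf]
  rw [smul_eq_mul, Ideal.mul_top] at htop
  exact RingHom.ker_ne_top _ (top_le_iff.mp (htop.trans_le hle))
end

section
/- Let $n \ge 2$ and let $A$ be a $d \times n$ complex matrix with columns $a_1,\dots,a_n \in \mathbb{C}^d$. Then the following are equivalent: (ii) there exists a partition $\{1,\dots,n\} = I \sqcup J$ with $I$ and $J$ both nonempty such that $\mathrm{span}(a_i \mid i \in I) \cap \mathrm{span}(a_j \mid j \in J) = 0$; (iii) there exists $\gamma = (\gamma_1,\dots,\gamma_n)$ with all $\gamma_i \ne 0$ and not all $\gamma_i$ equal, such that for every $v \in \mathbb{C}^n$ with $Av = 0$ one also has $A(\gamma_1 v_1, \dots, \gamma_n v_n)^T = 0$. -/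
/-- If the kernel of a family of vectors is stable under scaling coordinates by `γ`, then it is
stable under scaling coordinates by `∏ s ∈ S, (γ j - γ s)`. -/
theorem sum_prod_sub_mul_smul_eq_zero {K M ι : Type*} [CommRing K] [AddCommGroup M] [Module K M]
    [Fintype ι] (a : ι → M) (γ : ι → K)
    (hγ : ∀ v : ι → K, ∑ j, v j • a j = 0 → ∑ j, (γ j * v j) • a j = 0)
    (S : Finset ι) (v : ι → K) (hv : ∑ j, v j • a j = 0) :
    ∑ j, ((∏ s ∈ S, (γ j - γ s)) * v j) • a j = 0 := by
  classical
  induction S using Finset.induction_on with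
  | empty => simpa using hv
  | insert t S ht ih =>
    have h := hγ _ ih
    simp only [Finset.prod_insert ht, sub_mul, sub_smul, mul_assoc, Finset.sum_sub_distrib] at h ⊢
    rw [h, zero_sub, neg_eq_zero]
    simp only [mul_smul (γ t), ← Finset.smul_sum]
    rw [ih, smul_zero]

/-- Decomposability criterion: for columns `a₁,…,aₙ ∈ ℂ^d` (with `n ≥ 2`), there is a
nontrivial partition `{1,…,n} = I ⊔ J` with `span(aᵢ | i ∈ I) ∩ span(aⱼ | j ∈ J) = 0`
iff there is a vector `γ` with all entries nonzero and not all entries equal such that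
whenever `A v = 0` (i.e. `∑ⱼ vⱼ aⱼ = 0`) one also has `A (γ₁v₁,…,γₙvₙ)ᵀ = 0`. -/
theorem decomposable_iff_gamma (d n : ℕ) (hn : 2 ≤ n) (a : Fin n → Fin d → ℂ) :
    (∃ I J : Finset (Fin n), I.Nonempty ∧ J.Nonempty ∧ Disjoint I J ∧
      I ∪ J = Finset.univ ∧
      Submodule.span ℂ (a '' (I : Set (Fin n))) ⊓
        Submodule.span ℂ (a '' (J : Set (Fin n))) = ⊥) ↔
    (∃ γ : Fin n → ℂ, (∀ i, γ i ≠ 0) ∧ (∃ i j : Fin n, γ i ≠ γ j) ∧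
      ∀ v : Fin n → ℂ, (∑ j : Fin n, v j • a j = 0) →
        ∑ j : Fin n, (γ j * v j) • a j = 0) := by
  constructor
  · rintro ⟨I, J, ⟨i, hi⟩, ⟨j, hj⟩, hIJ, hU, hspan⟩
    have hjI : j ∉ I := Finset.disjoint_right.mp hIJ hj
    refine ⟨fun k => if k ∈ I then 1 else 2, fun k => by dsimp only; split_ifs <;> norm_num,
      ⟨i, j, by simp [hi, hjI]⟩, fun v hv => ?_⟩
    have hmem (S : Finset (Fin n)) :
        ∑ k ∈ S, v k • a k ∈ Submodule.span ℂ (a '' (S : Set (Fin n))) :=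
      Submodule.sum_mem _ fun k hk =>
        Submodule.smul_mem _ _ (Submodule.subset_span ⟨k, hk, rfl⟩)
    rw [← hU, Finset.sum_union hIJ] at hv
    have hI : ∑ k ∈ I, v k • a k = 0 := by
      rw [← Submodule.mem_bot ℂ, ← hspan]
      refine ⟨hmem I, ?_⟩
      rw [eq_neg_of_add_eq_zero_left hv]
      exact Submodule.neg_mem _ (hmem J)
    rw [hI, zero_add] at hv
    rw [← hU, Finset.sum_union hIJ]
    have h₁ : ∑ k ∈ I, ((if k ∈ I then (1 : ℂ) else 2) * v k) • a k = ∑ k ∈ I, v k • a k :=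
      Finset.sum_congr rfl fun k hk => by rw [if_pos hk, one_mul]
    have h₂ : ∑ k ∈ J, ((if k ∈ I then (1 : ℂ) else 2) * v k) • a k =
        (2 : ℂ) • ∑ k ∈ J, v k • a k := by
      rw [Finset.smul_sum]
      exact Finset.sum_congr rfl fun k hk => by
        rw [if_neg (Finset.disjoint_right.mp hIJ hk), mul_smul]
    rw [h₁, h₂, hI, hv, smul_zero, add_zero]
  · rintro ⟨γ, -, ⟨i, j, hij⟩, hγ⟩
    set I : Finset (Fin n) := {k | γ k = γ i} with hI
    set J : Finset (Fin n) := {k | ¬ γ k = γ i} with hJ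
    have hIJ : Disjoint I J := Finset.disjoint_filter_filter_not _ _ _
    have hU : I ∪ J = Finset.univ := Finset.filter_union_filter_not_eq _ _
    refine ⟨I, J, ⟨i, by simp [hI]⟩, ⟨j, by simpa [hJ] using hij.symm⟩, hIJ, hU, ?_⟩
    rw [eq_bot_iff]
    rintro x ⟨hxI, hxJ⟩
    obtain ⟨u, rfl⟩ := (Submodule.mem_span_image_finset_iff_exists_fun' ℂ).mp hxI
    obtain ⟨w, hw⟩ := (Submodule.mem_span_image_finset_iff_exists_fun' ℂ).mp hxJ
    rw [Submodule.mem_bot]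
    set v : Fin n → ℂ := fun k => if k ∈ I then u k else - w k with hv
    have hvI (k) (hk : k ∈ I) : v k = u k := if_pos hk
    have hvJ (k) (hk : k ∈ J) : v k = - w k := if_neg (Finset.disjoint_right.mp hIJ hk)
    have hker : ∑ k, v k • a k = 0 := by
      rw [← hU, Finset.sum_union hIJ,
        Finset.sum_congr rfl fun k hk => by rw [hvI k hk],
        Finset.sum_congr (s₁ := J) rfl fun k hk => by rw [hvJ k hk, neg_smul],
        Finset.sum_neg_distrib, hw, add_neg_cancel]
    have h := sum_prod_sub_mul_smul_eq_zero a γ hγ J v hker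
    have h₁ : ∑ k ∈ I, ((∏ s ∈ J, (γ k - γ s)) * v k) • a k =
        (∏ s ∈ J, (γ i - γ s)) • ∑ k ∈ I, u k • a k := by
      rw [Finset.smul_sum]
      refine Finset.sum_congr rfl fun k hk => ?_
      rw [hvI k hk, (Finset.mem_filter.mp hk).2, mul_smul]
    have h₂ : ∑ k ∈ J, ((∏ s ∈ J, (γ k - γ s)) * v k) • a k = 0 :=
      Finset.sum_eq_zero fun k hk => by
        rw [Finset.prod_eq_zero hk (sub_self _), zero_mul, zero_smul]
    rw [← hU, Finset.sum_union hIJ, h₁, h₂, add_zero] at h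
    refine (smul_eq_zero.mp h).resolve_left (Finset.prod_ne_zero_iff.mpr fun s hs => ?_)
    exact sub_ne_zero.mpr (Ne.symm (Finset.mem_filter.mp hs).2)
end

section
/- Let $b^{(1)},\dots,b^{(s)} \in \mathbb{Z}^m$ be such that the homomorphism $\overline{B}^T : \mathbb{Z}^s \to \mathbb{Z}^m$ sending the $k$-th standard basis vector $e_k$ to $b^{(k)}$ is surjective. Let $\ell_1,\dots,\ell_s$ be positive integers, $L = \ell_1 \cdots \ell_s$, $m_k = L/\ell_k$, and let $\widetilde{B}^T : \mathbb{Z}^s \to \mathbb{Z}^m$ be the homomorphism sending $e_k$ to $m_k b^{(k)}$. Then for every $(k_1,\dots,k_s) \in \mathbb{Z}^s$: there exists $p \in \mathbb{Z}^m$ with $\widetilde{B}^T(k_1,\dots,k_s) = L \cdot p$ if and only if there exists $(q_1,\dots,q_s) \in \mathbb{Z}^s$ with $\widetilde{B}^T(k_1 - \ell_1 q_1, \dots, k_s - \ell_s q_s) = 0$. -/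
/-- Let `B̄ᵀ : ℤ^s → ℤ^m`, `eₖ ↦ b⁽ᵏ⁾`, be surjective, let `ℓ₁,…,ℓₛ` be positive,
`L = ℓ₁⋯ℓₛ`, `mₖ = L/ℓₖ`, and let `B̃ᵀ : ℤ^s → ℤ^m` send `eₖ` to `mₖ b⁽ᵏ⁾`. Then for every
`k ∈ ℤ^s`, `B̃ᵀ k ∈ L·ℤ^m` iff there exists `q ∈ ℤ^s` with
`B̃ᵀ (k₁ - ℓ₁q₁, …, kₛ - ℓₛqₛ) = 0`. -/
theorem tildeB_divisible_iff (s m : ℕ) (b : Fin s → Fin m → ℤ)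
    (hsurj : Function.Surjective (fun v : Fin s → ℤ => ∑ k : Fin s, v k • b k))
    (ℓ : Fin s → ℕ) (hℓ : ∀ k, 0 < ℓ k)
    (L : ℕ) (hL : L = ∏ k : Fin s, ℓ k)
    (m' : Fin s → ℕ) (hm' : ∀ k, m' k = L / ℓ k)
    (Bt : (Fin s → ℤ) → (Fin m → ℤ))
    (hBt : ∀ v : Fin s → ℤ, Bt v = ∑ k : Fin s, (v k * (m' k : ℤ)) • b k) :
    ∀ K : Fin s → ℤ,
      (∃ p : Fin m → ℤ, Bt K = (L : ℤ) • p) ↔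
      (∃ Q : Fin s → ℤ, Bt (fun k => K k - (ℓ k : ℤ) * Q k) = 0) := by
  intro K
  have hmul : ∀ k, (ℓ k : ℤ) * (m' k : ℤ) = (L : ℤ) := fun k => by
    rw [hm' k, ← Nat.cast_mul,
      Nat.mul_div_cancel' (hL ▸ Finset.dvd_prod_of_mem ℓ (Finset.mem_univ k))]
  have hshift : ∀ Q : Fin s → ℤ,
      Bt (fun k => K k - (ℓ k : ℤ) * Q k) = Bt K - (L : ℤ) • ∑ k, Q k • b k := fun Q => by
    rw [hBt, hBt, Finset.smul_sum, ← Finset.sum_sub_distrib]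
    refine Finset.sum_congr rfl fun k _ => ?_
    rw [smul_smul, ← sub_smul, ← hmul k]
    congr 1
    ring
  constructor
  · rintro ⟨p, hp⟩
    obtain ⟨Q, rfl⟩ := hsurj p
    exact ⟨Q, by rw [hshift, hp, sub_self]⟩
  · rintro ⟨Q, hQ⟩
    exact ⟨∑ k, Q k • b k, by rwa [hshift, sub_eq_zero] at hQ⟩
end

section
/- Let $b^{(1)},\dots,b^{(s)} \in \mathbb{Z}^m$ be such that the homomorphism $\overline{B}^T : \mathbb{Z}^s \to \mathbb{Z}^m$ sending the $k$-th standard basis vector $e_k$ to $b^{(k)}$ is surjective. Let $\ell_1,\dots,\ell_s$ be positive integers, $L = \ell_1 \cdots \ell_s$, $m_k = L/\ell_k$, and let $\widetilde{B}^T : \mathbb{Z}^s \to \mathbb{Z}^m$ send $e_k$ to $m_k b^{(k)}$. Let $q : \mathbb{Z}^s \to \Gamma := \prod_{k=1}^s \mathbb{Z}/\ell_k\mathbb{Z}$ be the natural projection. Then $L\,\mathbb{Z}^m$ is contained in the image of $\widetilde{B}^T$, and there is a group isomorphism $\Gamma / q(\mathrm{Ker}\, \widetilde{B}^T) \cong (\mathrm{Image}\,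 \widetilde{B}^T) / L\,\mathbb{Z}^m$. -/
/-- Surjective homomorphisms out of the same group with the same kernel have isomorphic targets. -/
theorem AddMonoidHom.nonempty_addEquiv_of_ker_eq {G H K : Type*} [AddGroup G] [AddGroup H]
    [AddGroup K] (f : G →+ H) (g : G →+ K) (hf : Function.Surjective f)
    (hg : Function.Surjective g) (h : f.ker = g.ker) : Nonempty (H ≃+ K) :=
  ⟨(QuotientAddGroup.quotientKerEquivOfSurjective f hf).symm.trans
    ((QuotientAddGroup.quotientAddEquivOfEq h).trans
      (QuotientAddGroup.quotientKerEquivOfSurjective g hg))⟩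

/-- If `f` carries `ker q` onto `N`, then `Q / q(ker f) ≃ im f / N` for surjective `q : G → Q`. -/
theorem AddMonoidHom.nonempty_quotient_map_ker_addEquiv {G H Q : Type*} [AddCommGroup G]
    [AddCommGroup H] [AddCommGroup Q] (f : G →+ H) (q : G →+ Q) (hq : Function.Surjective q)
    (N : AddSubgroup H) (hN : q.ker.map f = N) :
    Nonempty ((Q ⧸ f.ker.map q) ≃+ (f.range ⧸ N.addSubgroupOf f.range)) := by
  refine nonempty_addEquiv_of_ker_eq
    ((QuotientAddGroup.mk' (f.ker.map q)).comp q)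
    ((QuotientAddGroup.mk' (N.addSubgroupOf f.range)).comp f.rangeRestrict)
    ((QuotientAddGroup.mk'_surjective _).comp hq)
    ((QuotientAddGroup.mk'_surjective _).comp f.rangeRestrict_surjective) ?_
  rw [← AddMonoidHom.comap_ker, ← AddMonoidHom.comap_ker, QuotientAddGroup.ker_mk',
    QuotientAddGroup.ker_mk', AddSubgroup.comap_map_eq, ← hN]
  ext v
  rw [AddSubgroup.mem_comap, AddSubgroup.mem_addSubgroupOf, AddMonoidHom.coe_rangeRestrict,
    ← AddSubgroup.mem_comap, AddSubgroup.comap_map_eq, sup_comm]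

/-- Let `B̄ᵀ : ℤ^s → ℤ^m`, `eₖ ↦ b⁽ᵏ⁾`, be surjective, let `ℓ₁,…,ℓₛ` be positive,
`L = ℓ₁⋯ℓₛ`, `mₖ = L/ℓₖ`, and let `B̃ᵀ : ℤ^s → ℤ^m` send `eₖ` to `mₖ b⁽ᵏ⁾`. Let
`q : ℤ^s → Γ := ∏ₖ ℤ/ℓₖℤ` be the natural projection. Then `L·ℤ^m` is contained in the image
of `B̃ᵀ`, and `Γ / q(ker B̃ᵀ) ≅ (im B̃ᵀ) / L·ℤ^m` as groups. -/
theorem gamma_quotient_iso (s m : ℕ) (b : Fin s → Fin m → ℤ)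
    (hsurj : Function.Surjective (fun v : Fin s → ℤ => ∑ k : Fin s, v k • b k))
    (ℓ : Fin s → ℕ) (hℓ : ∀ k, 0 < ℓ k)
    (L : ℕ) (hL : L = ∏ k : Fin s, ℓ k)
    (m' : Fin s → ℕ) (hm' : ∀ k, m' k = L / ℓ k)
    (Bt : (Fin s → ℤ) →+ (Fin m → ℤ))
    (hBt : ∀ v : Fin s → ℤ, Bt v = ∑ k : Fin s, (v k * (m' k : ℤ)) • b k)
    (q : (Fin s → ℤ) →+ (∀ k : Fin s, ZMod (ℓ k)))
    (hq : ∀ (v : Fin s → ℤ) (k : Fin s), q v k = ((v k : ℤ) : ZMod (ℓ k)))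
    (LZm : AddSubgroup (Fin m → ℤ))
    (hLZm : ∀ w : Fin m → ℤ, w ∈ LZm ↔ ∀ j, (L : ℤ) ∣ w j) :
    LZm ≤ Bt.range ∧
    Nonempty (((∀ k : Fin s, ZMod (ℓ k)) ⧸ AddSubgroup.map q Bt.ker) ≃+
      (Bt.range ⧸ LZm.addSubgroupOf Bt.range)) := by
  have hLm : ∀ k, (ℓ k : ℤ) * (m' k : ℤ) = L := fun k => by
    rw [hm' k]
    exact_mod_cast Nat.mul_div_cancel' (hL ▸ Finset.dvd_prod_of_mem ℓ (Finset.mem_univ k))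
  have hq_surj : Function.Surjective q := fun g => by
    choose v hv using fun k => ZMod.intCast_surjective (g k)
    exact ⟨v, funext fun k => (hq v k).trans (hv k)⟩
  have hq_ker : ∀ v, v ∈ q.ker ↔ ∀ k, (ℓ k : ℤ) ∣ v k := fun v => by
    simp [AddMonoidHom.mem_ker, funext_iff, hq, ZMod.intCast_zmod_eq_zero_iff_dvd]
  have hBt_mul : ∀ c : Fin s → ℤ, Bt (fun k => ℓ k * c k) = (L : ℤ) • ∑ k, c k • b k := fun c => by
    rw [hBt, Finset.smul_sum]
    refine Finset.sum_congr rfl fun k _ => ?_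
    rw [smul_smul, ← hLm k]
    congr 1
    ring
  have hmap : q.ker.map Bt = LZm := by
    ext w
    rw [hLZm, AddSubgroup.mem_map]
    constructor
    · rintro ⟨v, hv, rfl⟩ j
      choose c hc using (hq_ker v).1 hv
      rw [funext hc, hBt_mul]
      exact dvd_mul_right _ _
    · intro hw
      choose u hu using hw
      obtain ⟨c, hc⟩ := hsurj u
      refine ⟨fun k => ℓ k * c k, (hq_ker _).2 fun k => dvd_mul_right _ _, ?_⟩
      rw [hBt_mul]
      exact (congrArg ((L : ℤ) • ·) hc).trans (funext fun j => (hu j).symm)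
  exact ⟨hmap ▸ AddSubgroup.map_le_range Bt _,
    Bt.nonempty_quotient_map_ker_addEquiv q hq_surj LZm hmap⟩
end
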